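/- For every natural number K there exists a constant C = C(K) ∈ ℕ such that the following holds: for every ring R and every finite K-approximate subring X ⊆ R there exist a subring R' of R and a two-sided ideal I of R' such that (1) X is contained in a union of C additive cosets of R', (2) I ⊆ X₃ (where X₀ = X and X_{n+1} = X_n + X_n + X_n·X_n), and (3) the quotient ring R'/I is nilpotent of class at most C. -/

import Mathlib

open Pointwise

universe u

/-- A subset of a ring is additively symmetric if it contains `0` and equals its negation. -/
def AddSymm {R : Type u} [NonUnitalRing R] (X : Set R) : Prop :=
  (0 : R) ∈ X ∧ X = -X

/-- `X` is a `K`-approximate subring: it is additively symmetric and `X·X ∪ (X+X)` is covered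
by at most `K` additive translates of `X`. -/
def IsApproxSubringWith {R : Type u} [NonUnitalRing R] (K : ℕ) (X : Set R) : Prop :=
  AddSymm X ∧ ∃ F : Finset R, F.card ≤ K ∧ (X * X) ∪ (X + X) ⊆ (F : Set R) + X

/-- `iterX X n` is `Xₙ` where `X₀ = X` and `X_{n+1} = X_n + X_n + X_n · X_n`. -/
def iterX {R : Type u} [NonUnitalRing R] (X : Set R) : ℕ → Set R
  | 0 => X
  | n + 1 => iterX X n + iterX X n + iterX X n * iterX X n

/-- `mulIter S n` is the set of (left-nested) products of `n+1` elements of `S`. -/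
def mulIter {R : Type u} [NonUnitalRing R] (S : Set R) : ℕ → Set R
  | 0 => S
  | n + 1 => mulIter S n * S

/-- `S` is a subring of the ambient ring (as a set). -/
def IsSubringSet {R : Type u} [NonUnitalRing R] (S : Set R) : Prop :=
  (0 : R) ∈ S ∧ (∀ x ∈ S, ∀ y ∈ S, x + y ∈ S) ∧ (∀ x ∈ S, -x ∈ S) ∧
    ∀ x ∈ S, ∀ y ∈ S, x * y ∈ S

/-- `I` is a two-sided ideal of the subring `S` (both given as sets). -/
def IsTwoSidedIdealIn {R : Type u} [NonUnitalRing R] (I S : Set R) : Prop :=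
  I ⊆ S ∧ (0 : R) ∈ I ∧ (∀ x ∈ I, ∀ y ∈ I, x + y ∈ I) ∧ (∀ x ∈ I, -x ∈ I) ∧
    ∀ r ∈ S, ∀ x ∈ I, r * x ∈ I ∧ x * r ∈ I

section CircleFacts

/-- The unit circle, additively. -/
abbrev TT : Type := AddCircle (1 : ℝ)

/-- The standard character of the circle. -/
noncomputable def ee (t : TT) : ℂ := (AddCircle.toCircle t : ℂ)

lemma ee_add (a b : TT) : ee (a + b) = ee a * ee b := by
  simp [ee, AddCircle.toCircle_add]

lemma ee_zero : ee 0 = 1 := by simp [ee]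

lemma norm_ee (a : TT) : ‖ee a‖ = 1 := Circle.norm_coe _

lemma ee_neg (a : TT) : ee (-a) = (starRingEnd ℂ) (ee a) := by
  rw [ee, AddCircle.toCircle_neg, Circle.coe_inv_eq_conj]
  rfl

lemma ee_sub (a b : TT) : ee (a - b) = ee a * (starRingEnd ℂ) (ee b) := by
  rw [sub_eq_add_neg, ee_add, ee_neg]

lemma exists_rep (t : TT) : ∃ x : ℝ, (x : TT) = t ∧ ‖t‖ = |x| ∧ |x| ≤ 1 / 2 := by
  induction t using QuotientAddGroup.induction_on with
  | H z =>
    refine ⟨z - round z, ?_, ?_, ?_⟩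
    · have : ((round z : ℝ) : TT) = 0 := by
        rw [AddCircle.coe_eq_zero_iff]
        exact ⟨round z, by simp⟩
      rw [AddCircle.coe_sub, this, sub_zero]
    · exact UnitAddCircle.norm_eq
    · exact abs_sub_round z

lemma norm_coe_le (x : ℝ) : ‖(x : TT)‖ ≤ |x| := by
  have : ‖(x : TT)‖ = |x - round x| := UnitAddCircle.norm_eq
  rw [this]
  simpa using round_le x 0

lemma norm_coe_of_le {x : ℝ} (h : |x| ≤ 1 / 2) : ‖(x : TT)‖ = |x| :=
  (AddCircle.norm_coe_eq_abs_iff (p := (1 : ℝ)) one_ne_zero).2 (by simpa using h)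

lemma ee_coe (x : ℝ) : ee (x : TT) = Complex.exp ((2 * Real.pi * x : ℝ) * Complex.I) := by
  simp [ee, AddCircle.toCircle_apply_mk]

lemma ee_re (x : ℝ) : (ee (x : TT)).re = Real.cos (2 * Real.pi * x) := by
  rw [ee_coe, Complex.exp_ofReal_mul_I_re]

lemma norm_ee_sub_one_le (t : TT) : ‖ee t - 1‖ ≤ 7 * ‖t‖ := by
  obtain ⟨x, rfl, hx, -⟩ := exists_rep t
  rw [hx, ee_coe]
  have := Real.norm_exp_I_mul_ofReal_sub_one_le (x := 2 * Real.pi * x)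
  rw [mul_comm]
  refine this.trans ?_
  rw [Real.norm_eq_abs, abs_mul, abs_of_pos (by positivity)]
  have := Real.pi_lt_d2
  nlinarith [abs_nonneg x]

lemma le_norm_ee_sub_one (t : TT) : ‖t‖ ≤ ‖ee t - 1‖ := by
  obtain ⟨x, rfl, hx, hx2⟩ := exists_rep t
  rw [hx, ee_coe, mul_comm, Complex.norm_exp_I_mul_ofReal_sub_one]
  have h1 : 2 * Real.pi * x / 2 = Real.pi * x := by ring
  rw [h1, norm_mul, Real.norm_eq_abs, Real.norm_eq_abs]
  have h2 := Real.mul_abs_le_abs_sin (x := Real.pi * x) (by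
    rw [abs_mul, abs_of_pos Real.pi_pos]; nlinarith [Real.pi_pos])
  rw [abs_mul, abs_of_pos Real.pi_pos] at h2
  have h3 : 2 / Real.pi * (Real.pi * |x|) = 2 * |x| := by
    field_simp
  rw [h3] at h2
  have : |(2 : ℝ)| = 2 := by norm_num
  rw [this]
  linarith [abs_nonneg x]

lemma ee_re_nonneg {t : TT} (h : ‖t‖ ≤ 1 / 4) : 0 ≤ (ee t).re := by
  obtain ⟨x, rfl, hx, hx2⟩ := exists_rep t
  rw [ee_re]
  rw [hx] at h
  have := abs_le.1 h
  apply Real.cos_nonneg_of_mem_Icc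
  constructor <;> nlinarith [Real.pi_pos, this.1, this.2]

lemma ee_re_ge (t : TT) : 1 - 7 * ‖t‖ ≤ (ee t).re := by
  have h := norm_ee_sub_one_le t
  have h2 := Complex.abs_re_le_norm (ee t - 1)
  have h3 := neg_abs_le (ee t - 1).re
  simp at h3 h2
  linarith

lemma ee_ne_one {t : TT} (h : t ≠ 0) : ee t ≠ 1 := by
  intro h1
  have := le_norm_ee_sub_one t
  rw [h1, sub_self, norm_zero] at this
  exact h (norm_le_zero_iff.1 this)

/-- If all small multiples are small, the element is very small. -/
lemma nsmul_small {t : TT} {n : ℕ} (h : ∀ k ≤ n, ‖k • t‖ ≤ 1 / 32) : (n : ℝ) * ‖t‖ ≤ 1 / 32 := by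
  obtain ⟨x, rfl, hx, hx2⟩ := exists_rep t
  induction n with
  | zero => simp
  | succ n ih =>
    have h1 := ih (fun k hk => h k (by omega))
    rcases Nat.eq_zero_or_pos n with rfl | hn
    · simpa using h 1 le_rfl
    have h2 := h (n + 1) le_rfl
    have hn1 : (1 : ℝ) ≤ n := by exact_mod_cast hn
    rw [hx] at h1 ⊢
    have h3 : (n + 1) • (x : TT) = (((n + 1 : ℕ) * x : ℝ) : TT) := by
      rw [← nsmul_eq_mul, AddCircle.coe_nsmul]
    have h4 : |((n + 1 : ℕ) * x : ℝ)| = ((n + 1 : ℕ) : ℝ) * |x| := by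
      rw [abs_mul, abs_of_nonneg (by positivity)]
    rw [h3, norm_coe_of_le, h4] at h2
    · exact h2
    · rw [h4]; push_cast; nlinarith [abs_nonneg x]

/-- Finite colouring of the circle with small colour classes. -/
lemma circle_coloring (r : ℝ) (hr : 0 < r) : ∃ N : ℕ, ∃ c : TT → Fin N,
    ∀ a b, c a = c b → ‖a - b‖ ≤ r := by
  obtain ⟨s, -, hs, hcov⟩ := (isCompact_univ (X := TT)).finite_cover_balls (half_pos hr)
  have : ∀ a : TT, ∃ x : s, dist a x < r / 2 := fun a => by
    have := hcov (Set.mem_univ a)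
    simp only [Set.mem_iUnion, Metric.mem_ball] at this
    obtain ⟨x, hx, hd⟩ := this
    exact ⟨⟨x, hx⟩, hd⟩
  choose f hf using this
  have := hs.fintype
  refine ⟨Fintype.card s, fun a => Fintype.equivFin s (f a), fun a b hab => ?_⟩
  have hab' : f a = f b := (Fintype.equivFin s).injective hab
  have h1 := hf a
  have h2 := hf b
  rw [← hab'] at h2
  rw [← dist_eq_norm]
  have := dist_triangle_right a b (f a : TT)
  linarith

end CircleFacts

section Endgame

/-- The data produced by the Fourier-analytic part of the argument. -/
structure EndData (R : Type u) [NonUnitalRing R] (ι : Type u) [Fintype ι] where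
  G : AddSubgroup R
  φ : R → ι → TT
  W : Set R
  S : Set R
  Wfin : W.Finite
  WG : ∀ w ∈ W, w ∈ G
  W0 : (0 : R) ∈ W
  Wneg : ∀ w ∈ W, -w ∈ W
  φadd : ∀ x ∈ G, ∀ y ∈ G, φ (x + y) = φ x + φ y
  cl : ∀ x ∈ W, ∀ y ∈ W, ‖φ x‖ ≤ 1 / 8 → ‖φ y‖ ≤ 1 / 8 → ‖φ (x + y)‖ ≤ 1 / 8 → x + y ∈ W
  SW : ∀ s ∈ S, s ∈ W ∧ ‖φ s‖ ≤ 1 / 8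
  left : ∀ s ∈ S, ∀ b ∈ W, ‖φ b‖ ≤ 1 / 8 → s * b ∈ W ∧ ‖φ (s * b)‖ ≤ 1 / 32
  right : ∀ s ∈ S, ∀ b ∈ W, ‖φ b‖ ≤ 1 / 8 → b * s ∈ W ∧ ‖φ (b * s)‖ ≤ 1 / 32

namespace EndData

variable {R : Type u} [NonUnitalRing R] {ι : Type u} [Fintype ι] (E : EndData R ι)

lemma φzero : E.φ 0 = 0 := by
  have := E.φadd 0 E.G.zero_mem 0 E.G.zero_mem
  simpa using this

lemma φneg {x : R} (hx : x ∈ E.G) : E.φ (-x) = -E.φ x := by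
  have := E.φadd x hx (-x) (E.G.neg_mem hx)
  rw [add_neg_cancel, E.φzero] at this
  exact (neg_eq_of_add_eq_zero_right this.symm).symm

lemma φnsmul {x : R} (hx : x ∈ E.G) (k : ℕ) : E.φ (k • x) = k • E.φ x := by
  induction k with
  | zero => simp [E.φzero]
  | succ k ih => rw [succ_nsmul, E.φadd _ (E.G.nsmul_mem hx k) _ hx, ih, succ_nsmul]

/-- The small elements. -/
def B : Set R := {w | w ∈ E.W ∧ ‖E.φ w‖ ≤ 1 / 8}

lemma Bneg {b : R} (hb : b ∈ E.B) : -b ∈ E.B :=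
  ⟨E.Wneg _ hb.1, by rw [E.φneg (E.WG _ hb.1), norm_neg]; exact hb.2⟩

/-- The kernel. -/
def H : AddSubgroup R where
  carrier := {w | w ∈ E.W ∧ E.φ w = 0}
  zero_mem' := ⟨E.W0, E.φzero⟩
  add_mem' := by
    rintro a b ⟨ha, ha'⟩ ⟨hb, hb'⟩
    have h : E.φ (a + b) = 0 := by rw [E.φadd _ (E.WG _ ha) _ (E.WG _ hb), ha', hb', add_zero]
    refine ⟨E.cl _ ha _ hb ?_ ?_ ?_, h⟩ <;> simp [ha', hb', h]
  neg_mem' := by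
    rintro a ⟨ha, ha'⟩
    exact ⟨E.Wneg _ ha, by rw [E.φneg (E.WG _ ha), ha', neg_zero]⟩

lemma nsmul_mem_B {b : R} (hb : b ∈ E.B) (k : ℕ) (hk : (k : ℝ) * ‖E.φ b‖ ≤ 1 / 8) :
    k • b ∈ E.B := by
  have hn : ∀ k : ℕ, ‖E.φ (k • b)‖ ≤ k * ‖E.φ b‖ := fun k => by
    rw [E.φnsmul (E.WG _ hb.1)]
    exact norm_nsmul_le
  induction k with
  | zero => simpa using ⟨E.W0, by simp [E.φzero]⟩
  | succ k ih =>
    push_cast at hk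
    have h1 : (k : ℝ) * ‖E.φ b‖ ≤ 1 / 8 := by nlinarith [norm_nonneg (E.φ b)]
    have h2 := hn (k + 1)
    push_cast at h2
    have h3 := ih h1
    refine ⟨?_, h2.trans hk⟩
    rw [succ_nsmul]
    refine E.cl _ h3.1 _ hb.1 h3.2 hb.2 ?_
    rw [← succ_nsmul]
    exact h2.trans hk

lemma contract_aux {b c : R} (hb : b ∈ E.B) (hc : c ∈ E.W)
    (h : ∀ k : ℕ, k • b ∈ E.B → ‖E.φ (k • c)‖ ≤ 1 / 32) :
    (E.φ b = 0 → E.φ c = 0) ∧ (E.φ b ≠ 0 → ‖E.φ c‖ < ‖E.φ b‖) := by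
  have key : ∀ n : ℕ, (n : ℝ) * ‖E.φ b‖ ≤ 1 / 8 → (n : ℝ) * ‖E.φ c‖ ≤ 1 / 32 := by
    intro n hn
    rcases Nat.eq_zero_or_pos n with rfl | hn0
    · simp
    have hn0' : (0 : ℝ) < n := by exact_mod_cast hn0
    rw [mul_comm, ← le_div_iff₀ hn0']
    rw [pi_norm_le_iff_of_nonneg (by positivity)]
    intro i
    rw [le_div_iff₀ hn0', mul_comm]
    apply nsmul_small
    intro k hk
    have h1 : (k : ℝ) * ‖E.φ b‖ ≤ 1 / 8 := by
      have : (k : ℝ) ≤ n := by exact_mod_cast hk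
      nlinarith [norm_nonneg (E.φ b)]
    have h2 := h k (E.nsmul_mem_B hb k h1)
    rw [E.φnsmul (E.WG _ hc)] at h2
    exact (norm_le_pi_norm (k • E.φ c) i).trans h2
  constructor
  · intro h0
    by_contra hne
    have hpos : 0 < ‖E.φ c‖ := norm_pos_iff.2 hne
    obtain ⟨n, hn⟩ := exists_nat_gt (1 / ‖E.φ c‖)
    have h1 := key n (by simp [h0])
    rw [div_lt_iff₀ hpos] at hn
    linarith
  · intro hne
    have hpos : 0 < ‖E.φ b‖ := norm_pos_iff.2 hne
    set n := ⌊1 / (8 * ‖E.φ b‖)⌋₊ with hn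
    have hx : 0 < 1 / (8 * ‖E.φ b‖) := by positivity
    have h1 : (n : ℝ) ≤ 1 / (8 * ‖E.φ b‖) := Nat.floor_le hx.le
    have h2 : 1 / (8 * ‖E.φ b‖) < n + 1 := Nat.lt_floor_add_one _
    have hge : 1 ≤ n := by
      rw [hn, Nat.one_le_floor_iff, le_div_iff₀ (by positivity)]
      have := hb.2
      linarith
    have hge' : (1 : ℝ) ≤ n := by exact_mod_cast hge
    rw [le_div_iff₀ (by positivity)] at h1
    rw [div_lt_iff₀ (by positivity)] at h2
    have h3 := key n (by linarith)
    by_contra hcon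
    push Not at hcon
    nlinarith

lemma contract_left {s b : R} (hs : s ∈ E.S) (hb : b ∈ E.B) : s * b ∈ E.B ∧
    (E.φ b = 0 → E.φ (s * b) = 0) ∧ (E.φ b ≠ 0 → ‖E.φ (s * b)‖ < ‖E.φ b‖) := by
  have h := E.left s hs b hb.1 hb.2
  refine ⟨⟨h.1, h.2.trans (by norm_num)⟩, E.contract_aux hb h.1 fun k hk => ?_⟩
  have := (E.left s hs _ hk.1 hk.2).2
  rwa [mul_smul_comm] at this

lemma contract_right {s b : R} (hs : s ∈ E.S) (hb : b ∈ E.B) : b * s ∈ E.B ∧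
    (E.φ b = 0 → E.φ (b * s) = 0) ∧ (E.φ b ≠ 0 → ‖E.φ (b * s)‖ < ‖E.φ b‖) := by
  have h := E.right s hs b hb.1 hb.2
  refine ⟨⟨h.1, h.2.trans (by norm_num)⟩, E.contract_aux hb h.1 fun k hk => ?_⟩
  have := (E.right s hs _ hk.1 hk.2).2
  rwa [smul_mul_assoc] at this

lemma exists_pick (J : AddSubgroup R) : ∃ u : R,
    (E.B ⊆ J → u = 0) ∧
    (¬ E.B ⊆ J → u ∈ E.B ∧ u ∉ J ∧ ∀ b ∈ E.B, ‖E.φ b‖ < ‖E.φ u‖ → b ∈ J) := by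
  by_cases h : E.B ⊆ J
  · exact ⟨0, fun _ => rfl, fun h' => (h' h).elim⟩
  · have hne : (E.B \ J).Nonempty := Set.sdiff_nonempty.2 h
    have hfin : (E.B \ (J : Set R)).Finite := (E.Wfin.subset fun x hx => hx.1).subset Set.sdiff_subset
    obtain ⟨u, hu, hmin⟩ := Set.exists_min_image (E.B \ (J : Set R)) (fun x => ‖E.φ x‖) hfin hne
    refine ⟨u, fun h' => (h h').elim, fun _ => ⟨hu.1, hu.2, fun b hb hlt => ?_⟩⟩
    by_contra hbJ
    exact absurd (hmin b ⟨hb, hbJ⟩) (not_le.2 hlt)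

/-- The minimal element outside a subgroup. -/
noncomputable def pick (J : AddSubgroup R) : R := (E.exists_pick J).choose

/-- The filtration. -/
noncomputable def J : ℕ → AddSubgroup R
  | 0 => E.H
  | k + 1 => J k ⊔ AddSubgroup.zmultiples (E.pick (J k))

lemma J_mono : Monotone E.J := monotone_nat_of_le_succ fun _ => le_sup_left

lemma pick_mem_J (k : ℕ) : E.pick (E.J k) ∈ E.J (k + 1) :=
  (le_sup_right : _ ≤ E.J (k + 1)) (AddSubgroup.mem_zmultiples _)

lemma H_le_J (k : ℕ) : E.H ≤ E.J k := E.J_mono (Nat.zero_le k)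

lemma H_sub_B {b : R} (hb : b ∈ E.H) : b ∈ E.B := ⟨hb.1, by rw [hb.2]; simp⟩

lemma S_mul_H {s h : R} (hs : s ∈ E.S) (hh : h ∈ E.H) : s * h ∈ E.H ∧ h * s ∈ E.H := by
  have h1 := E.contract_left hs (E.H_sub_B hh)
  have h2 := E.contract_right hs (E.H_sub_B hh)
  exact ⟨⟨h1.1.1, h1.2.1 hh.2⟩, ⟨h2.1.1, h2.2.1 hh.2⟩⟩

lemma S_mul_pick {s : R} (hs : s ∈ E.S) (k : ℕ) :
    s * E.pick (E.J k) ∈ E.J k ∧ E.pick (E.J k) * s ∈ E.J k := by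
  have hp := (E.exists_pick (E.J k)).choose_spec
  by_cases h : E.B ⊆ E.J k
  · have h0 : E.pick (E.J k) = 0 := hp.1 h
    simp [h0, (E.J k).zero_mem]
  · obtain ⟨h1, h2, h3⟩ := hp.2 h
    have hne : E.φ (E.pick (E.J k)) ≠ 0 := fun h0 => h2 (E.H_le_J k ⟨h1.1, h0⟩)
    have hl := E.contract_left hs h1
    have hr := E.contract_right hs h1
    exact ⟨h3 _ hl.1 (hl.2.2 hne), h3 _ hr.1 (hr.2.2 hne)⟩

lemma S_mul_J {s : R} (hs : s ∈ E.S) (k : ℕ) : ∀ j ∈ E.J (k + 1),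
    s * j ∈ E.J k ∧ j * s ∈ E.J k := by
  have step : ∀ k, (∀ j ∈ E.J k, s * j ∈ E.J k ∧ j * s ∈ E.J k) →
      ∀ j ∈ E.J (k + 1), s * j ∈ E.J k ∧ j * s ∈ E.J k := by
    intro k ih j hj
    obtain ⟨a, ha, b, hb, rfl⟩ := AddSubgroup.mem_sup.1 hj
    obtain ⟨z, rfl⟩ := AddSubgroup.mem_zmultiples_iff.1 hb
    have hp := E.S_mul_pick hs k
    have ha' := ih a ha
    rw [mul_add, add_mul, mul_smul_comm, smul_mul_assoc]
    exact ⟨add_mem ha'.1 (zsmul_mem hp.1 z), add_mem ha'.2 (zsmul_mem hp.2 z)⟩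
  induction k with
  | zero => exact step 0 fun j hj => E.S_mul_H hs hj
  | succ k ih =>
    exact step (k + 1) fun j hj => ⟨E.J_mono (Nat.le_succ k) (ih j hj).1,
      E.J_mono (Nat.le_succ k) (ih j hj).2⟩

/-- The subring generated by `S`. -/
def R' : NonUnitalSubring R := NonUnitalSubring.closure E.S

lemma R'_mul_J {x : R} (hx : x ∈ E.R') (k : ℕ) : ∀ j ∈ E.J (k + 1),
    x * j ∈ E.J k ∧ j * x ∈ E.J k := by
  induction hx using NonUnitalSubring.closure_induction with
  | mem s hs => exact E.S_mul_J hs k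
  | zero => intro j _; simp [(E.J k).zero_mem]
  | add x y _ _ hx hy =>
    intro j hj
    rw [add_mul, mul_add]
    exact ⟨add_mem (hx j hj).1 (hy j hj).1, add_mem (hx j hj).2 (hy j hj).2⟩
  | neg x _ hx =>
    intro j hj
    rw [neg_mul, mul_neg]
    exact ⟨neg_mem (hx j hj).1, neg_mem (hx j hj).2⟩
  | mul x y _ _ hx hy =>
    intro j hj
    rw [mul_assoc, ← mul_assoc j]
    exact ⟨(hx _ (E.J_mono (Nat.le_succ k) (hy j hj).1)).1,
      (hy _ (E.J_mono (Nat.le_succ k) (hx j hj).2)).2⟩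

lemma R'_mul_H {x : R} (hx : x ∈ E.R') : ∀ j ∈ E.H, x * j ∈ E.H ∧ j * x ∈ E.H := fun j hj =>
  E.R'_mul_J hx 0 j (E.H_le_J 1 hj)

lemma R'_sub_J {r : ℕ} (hr : E.B ⊆ E.J r) {x : R} (hx : x ∈ E.R') : x ∈ E.J r := by
  induction hx using NonUnitalSubring.closure_induction with
  | mem s hs => exact hr (E.SW s hs)
  | zero => exact zero_mem _
  | add x y _ _ hx hy => exact add_mem hx hy
  | neg x _ hx => exact neg_mem hx
  | mul x y hx' _ hx hy => exact (E.R'_mul_J hx' r y (E.J_mono (Nat.le_succ r) hy)).1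

lemma mulIter_sub {r : ℕ} (hr : E.B ⊆ E.J r) (n : ℕ) :
    mulIter (E.R' : Set R) n ⊆ E.J (r - n) ∩ E.R' := by
  induction n with
  | zero => exact fun x hx => ⟨E.R'_sub_J hr hx, hx⟩
  | succ n ih =>
    rintro _ ⟨a, ha, b, hb, rfl⟩
    obtain ⟨h1, h2⟩ := ih ha
    refine ⟨?_, mul_mem h2 hb⟩
    refine (E.R'_mul_J hb _ a (E.J_mono (by omega) h1)).2

/-- Packing bound: the filtration stabilises after boundedly many steps. -/
lemma exists_stable (d : ℕ) (hd : Fintype.card ι ≤ d) : E.B ⊆ E.J (9 ^ d) := by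
  classical
  by_contra hcon
  have hn : ∀ k ≤ 9 ^ d, ¬ E.B ⊆ E.J k := fun k hk h =>
    hcon (h.trans (E.J_mono hk))
  set u : ℕ → R := fun k => E.pick (E.J k) with hu
  have hu1 : ∀ k ≤ 9 ^ d, u k ∈ E.B ∧ u k ∉ E.J k ∧
      ∀ b ∈ E.B, ‖E.φ b‖ < ‖E.φ (u k)‖ → b ∈ E.J k := fun k hk =>
    (E.exists_pick (E.J k)).choose_spec.2 (hn k hk)
  have hrep : ∀ k, ∃ θ : ι → ℝ, ∀ i, (θ i : TT) = E.φ (u k) i ∧ ‖E.φ (u k) i‖ = |θ i| := by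
    intro k
    choose θ h1 h2 _ using fun i => exists_rep (E.φ (u k) i)
    exact ⟨θ, fun i => ⟨h1 i, h2 i⟩⟩
  choose θ hθ using hrep
  set ν : ℕ → ℝ := fun k => ‖E.φ (u k)‖ with hν
  have hνpos : ∀ k ≤ 9 ^ d, 0 < ν k := fun k hk => norm_pos_iff.2 fun h0 =>
    (hu1 k hk).2.1 (E.H_le_J k ⟨(hu1 k hk).1.1, h0⟩)
  have hνmono : ∀ i j, i ≤ j → j ≤ 9 ^ d → ν i ≤ ν j := fun i j hij hj => by
    by_contra hlt
    push Not at hlt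
    exact (hu1 j hj).2.1 (E.J_mono hij ((hu1 i (hij.trans hj)).2.2 _ (hu1 j hj).1 hlt))
  have hθν : ∀ k i, |θ k i| ≤ ν k := fun k i => by
    rw [← (hθ k i).2]; exact norm_le_pi_norm (E.φ (u k)) i
  -- colouring
  let col : Fin (9 ^ d + 1) → ι → Finset.Icc (-4 : ℤ) 4 := fun k i =>
    ⟨⌊4 * (θ k i / ν k)⌋, by
      have hk : (k : ℕ) ≤ 9 ^ d := by omega
      have h1 := abs_le.1 (hθν k i)
      have h0 := hνpos k hk
      have h2 : θ k i / ν k ≤ 1 := (div_le_one h0).2 h1.2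
      have h3 : -1 ≤ θ k i / ν k := by rw [le_div_iff₀ h0]; linarith
      rw [Finset.mem_Icc, Int.le_floor]
      refine ⟨by push_cast; linarith, ?_⟩
      have : ⌊4 * (θ k i / ν k)⌋ ≤ ⌊(4 : ℝ)⌋ := Int.floor_le_floor (by linarith)
      simpa using this⟩
  have hcard : Fintype.card (ι → Finset.Icc (-4 : ℤ) 4) < Fintype.card (Fin (9 ^ d + 1)) := by
    rw [Fintype.card_fun, Fintype.card_coe, Fintype.card_fin]
    have : (Finset.Icc (-4 : ℤ) 4).card = 9 := by simp
    rw [this]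
    have := Nat.pow_le_pow_right (show 0 < 9 by norm_num) hd
    omega
  obtain ⟨i₀, j₀, hne₀, hcol₀⟩ := Fintype.exists_ne_map_eq_of_card_lt col hcard
  obtain ⟨i, j, hlt, hcol⟩ : ∃ i j : Fin (9 ^ d + 1), i < j ∧ col i = col j := by
    rcases lt_or_gt_of_ne hne₀ with h | h
    · exact ⟨i₀, j₀, h, hcol₀⟩
    · exact ⟨j₀, i₀, h, hcol₀.symm⟩
  have hi : (i : ℕ) ≤ 9 ^ d := by omega
  have hj : (j : ℕ) ≤ 9 ^ d := by omega
  have hij : (i : ℕ) < j := hlt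
  have hνi := hνpos i hi
  have hνj := hνpos j hj
  have hle := hνmono i j hij.le hj
  set c := ⌊ν j / ν i⌋₊ with hc
  have hc1 : (c : ℝ) ≤ ν j / ν i := Nat.floor_le (by positivity)
  have hc2 : ν j / ν i < c + 1 := Nat.lt_floor_add_one _
  have hc3 : 1 ≤ c := by rw [hc, Nat.one_le_floor_iff, le_div_iff₀ hνi]; linarith
  have hc3' : (1 : ℝ) ≤ c := by exact_mod_cast hc3
  rw [le_div_iff₀ hνi] at hc1
  rw [div_lt_iff₀ hνi] at hc2
  have huj := hu1 j hj
  have hui := hu1 i hi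
  have hcB : c • u i ∈ E.B := E.nsmul_mem_B hui.1 c (hc1.trans huj.1.2)
  have hGi := E.WG _ hui.1.1
  have hGj := E.WG _ huj.1.1
  have hφ : E.φ (u j + -(c • u i)) = E.φ (u j) - c • E.φ (u i) := by
    rw [E.φadd _ hGj _ (neg_mem (nsmul_mem hGi c)), E.φneg (nsmul_mem hGi c), E.φnsmul hGi,
      sub_eq_add_neg]
  have hnorm : ‖E.φ (u j + -(c • u i))‖ < ν j := by
    rw [hφ, pi_norm_lt_iff hνj]
    intro a
    have h1 : (E.φ (u j) - c • E.φ (u i)) a = ((θ j a - c * θ i a : ℝ) : TT) := by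
      rw [Pi.sub_apply, Pi.smul_apply, ← (hθ j a).1, ← (hθ i a).1, AddCircle.coe_sub,
        ← nsmul_eq_mul, AddCircle.coe_nsmul]
    rw [h1]
    refine (norm_coe_le _).trans_lt ?_
    have h2 : ⌊4 * (θ i a / ν i)⌋ = ⌊4 * (θ j a / ν j)⌋ :=
      congrArg Subtype.val (congrFun hcol a)
    have h3 := Int.abs_sub_lt_one_of_floor_eq_floor h2
    set x := θ i a / ν i with hx
    set y := θ j a / ν j with hy
    have hθi : θ i a = x * ν i := by rw [hx]; field_simp
    have hθj : θ j a = y * ν j := by rw [hy]; field_simp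
    have hy1 : |y| ≤ 1 := by
      rw [hy, abs_div, abs_of_pos hνj, div_le_one hνj]; exact hθν j a
    have h4 : |y - x| ≤ 1 / 4 := by
      have : 4 * x - 4 * y = -4 * (y - x) := by ring
      rw [this, abs_mul] at h3
      norm_num at h3
      linarith
    have h5 : θ j a - c * θ i a = y * (ν j - c * ν i) + (c * ν i) * (y - x) := by
      rw [hθi, hθj]; ring
    rw [h5]
    refine (abs_add_le _ _).trans_lt ?_
    rw [abs_mul, abs_mul, abs_of_nonneg (show 0 ≤ ν j - c * ν i by linarith),
      abs_of_nonneg (show 0 ≤ c * ν i by positivity)]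
    have h6 : |y| * (ν j - c * ν i) ≤ 1 * (ν j - c * ν i) :=
      mul_le_mul_of_nonneg_right hy1 (by linarith)
    have h7 : (c * ν i) * |y - x| ≤ (c * ν i) * (1 / 4) :=
      mul_le_mul_of_nonneg_left h4 (by positivity)
    nlinarith
  have hB : u j + -(c • u i) ∈ E.B :=
    ⟨E.cl _ huj.1.1 _ (E.Bneg hcB).1 huj.1.2 (E.Bneg hcB).2 (hnorm.le.trans huj.1.2),
      hnorm.le.trans huj.1.2⟩
  have hJ := huj.2.2 _ hB hnorm
  have hcJ : c • u i ∈ E.J j :=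
    nsmul_mem (E.J_mono (Nat.succ_le_of_lt hij) (E.pick_mem_J i)) c
  apply huj.2.1
  have := add_mem hJ hcJ
  simpa using this

theorem conclusion (d : ℕ) (hd : Fintype.card ι ≤ d) : ∃ R' I : Set R,
    IsSubringSet R' ∧ IsTwoSidedIdealIn I R' ∧ E.S ⊆ R' ∧ I ⊆ E.W ∧
      ∀ n, 9 ^ d ≤ n → mulIter R' n ⊆ I := by
  have hst := E.exists_stable d hd
  refine ⟨E.R', E.H ∩ E.R', ⟨zero_mem E.R', fun x hx y hy => add_mem (S := NonUnitalSubring R) hx hy,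
    fun x hx => neg_mem (S := NonUnitalSubring R) hx, fun x hx y hy => mul_mem (S := NonUnitalSubring R) hx hy⟩, ?_,
    NonUnitalSubring.subset_closure, fun x hx => hx.1.1, ?_⟩
  · refine ⟨Set.inter_subset_right, ⟨zero_mem E.H, zero_mem E.R'⟩, fun x hx y hy =>
      ⟨add_mem (S := AddSubgroup R) hx.1 hy.1, add_mem (S := NonUnitalSubring R) hx.2 hy.2⟩,
      fun x hx => ⟨neg_mem (S := AddSubgroup R) hx.1, neg_mem (S := NonUnitalSubring R) hx.2⟩, fun r hr x hx => ?_⟩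
    have := E.R'_mul_H hr x hx.1
    exact ⟨⟨this.1, mul_mem (S := NonUnitalSubring R) hr hx.2⟩, ⟨this.2, mul_mem (S := NonUnitalSubring R) hx.2 hr⟩⟩
  · intro n hn x hx
    have := E.mulIter_sub hst n hx
    rw [Nat.sub_eq_zero_of_le hn] at this
    exact this

end EndData

end Endgame

section DualGroup

/-- `D` is a finite group of functions, additive on `G`, and separating the points of `P`
from zero. -/
structure IsDual {R : Type u} [AddCommGroup R] (G : AddSubgroup R) (P : Finset R)
    (D : Finset (R → TT)) : Prop where
  zero : (0 : R → TT) ∈ D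
  sub : ∀ χ ∈ D, ∀ ψ ∈ D, χ - ψ ∈ D
  hadd : ∀ χ ∈ D, ∀ x ∈ G, ∀ y ∈ G, χ (x + y) = χ x + χ y
  sep : ∀ x ∈ P, x ≠ 0 → ∃ χ ∈ D, χ x ≠ 0
  PG : ∀ x ∈ P, x ∈ G
  tors : ∀ χ ∈ D, ∃ N : ℕ, N ≠ 0 ∧ N • χ = 0

/-- The embedding of `ℚ/ℤ` in the circle. -/
noncomputable def qToT : AddCircle (1 : ℚ) →+ TT :=
  QuotientAddGroup.map _ _ (Rat.castHom ℝ).toAddMonoidHom (by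
    intro x hx
    rw [AddSubgroup.mem_zmultiples_iff] at hx
    obtain ⟨k, rfl⟩ := hx
    rw [AddSubgroup.mem_comap, AddSubgroup.mem_zmultiples_iff]
    exact ⟨k, by simp⟩)

lemma qToT_inj (x : AddCircle (1 : ℚ)) (h : qToT x = 0) : x = 0 := by
  induction x using QuotientAddGroup.induction_on with
  | H z =>
    have h1 : qToT (z : AddCircle (1 : ℚ)) = (((z : ℚ) : ℝ) : TT) := rfl
    rw [h1, AddCircle.coe_eq_zero_iff] at h
    obtain ⟨n, hn⟩ := h
    rw [AddCircle.coe_eq_zero_iff]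
    refine ⟨n, ?_⟩
    have : ((n : ℚ) : ℝ) = ((z : ℚ) : ℝ) := by simpa using hn
    have := Rat.cast_injective this
    simpa using this

lemma qcircle_torsion (x : AddCircle (1 : ℚ)) : ∃ N : ℕ, N ≠ 0 ∧ N • x = 0 := by
  induction x using QuotientAddGroup.induction_on with
  | H z =>
    refine ⟨z.den, z.den_nz, ?_⟩
    have : z.den • (z : AddCircle (1 : ℚ)) = ((z.den • z : ℚ) : AddCircle (1 : ℚ)) :=
      (AddCircle.coe_nsmul (1 : ℚ)).symm
    change z.den • (z : AddCircle (1 : ℚ)) = 0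
    rw [this, AddCircle.coe_eq_zero_iff]
    refine ⟨z.num, ?_⟩
    simp [Rat.den_mul_eq_num]

lemma exists_sep_function {R : Type u} [AddCommGroup R] (A : Finset R) (x : R)
    (hx : x ∈ AddSubgroup.closure (A : Set R)) (hx0 : x ≠ 0) :
    ∃ q : R → TT, (∀ y ∈ AddSubgroup.closure (A : Set R), ∀ z ∈ AddSubgroup.closure (A : Set R),
      q (y + z) = q y + q z) ∧ (∃ N : ℕ, N ≠ 0 ∧ N • q = 0) ∧ q x ≠ 0 := by
  classical
  set G := AddSubgroup.closure (A : Set R) with hG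
  obtain ⟨c, hc⟩ := CharacterModule.exists_character_apply_ne_zero_of_ne_zero (A := G)
    (a := ⟨x, hx⟩) (by simpa [Subtype.ext_iff] using hx0)
  let c' : G →+ AddCircle (1 : ℚ) := c
  have hc' : c' ⟨x, hx⟩ ≠ 0 := hc
  refine ⟨fun y => if h : y ∈ G then qToT (c' ⟨y, h⟩) else 0, ?_, ?_, ?_⟩
  · intro y hy z hz
    have : y + z ∈ G := add_mem hy hz
    simp only [hy, hz, this, dif_pos]
    rw [← map_add, ← map_add]
    rfl
  · have key : ∃ N : ℕ, N ≠ 0 ∧ ∀ y (h : y ∈ G), N • c' ⟨y, h⟩ = 0 := by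
      choose n hn0 hn using qcircle_torsion
      let f : R → ℕ := fun a => if h : a ∈ G then n (c' ⟨a, h⟩) else 1
      refine ⟨∏ a ∈ A, f a, ?_, ?_⟩
      · rw [Finset.prod_ne_zero_iff]
        intro a _
        simp only [f]
        split_ifs
        · exact hn0 _
        · exact one_ne_zero
      · intro y h
        have : ∀ (y : R) (h : y ∈ AddSubgroup.closure (A : Set R)),
            (∏ a ∈ A, f a) • c' ⟨y, h⟩ = 0 := by
          intro y h
          induction h using AddSubgroup.closure_induction with
          | mem a ha =>
            have haG : a ∈ G := AddSubgroup.subset_closure ha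
            obtain ⟨m, hm⟩ := Finset.dvd_prod_of_mem f (Finset.mem_coe.1 ha)
            rw [hm, mul_comm, mul_smul]
            have : f a = n (c' ⟨a, haG⟩) := by simp [f, haG]
            rw [this, hn, smul_zero]
          | zero =>
            have : c' ⟨0, zero_mem _⟩ = 0 := map_zero c'
            rw [this, smul_zero]
          | add a b ha hb iha ihb =>
            have : c' ⟨a + b, add_mem ha hb⟩ = c' ⟨a, ha⟩ + c' ⟨b, hb⟩ := by
              rw [← map_add]; rfl
            rw [this, smul_add, iha, ihb, add_zero]
          | neg a ha iha =>
            have : c' ⟨-a, neg_mem ha⟩ = - c' ⟨a, ha⟩ := by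
              rw [← map_neg]; rfl
            rw [this, smul_neg, iha, neg_zero]
        exact this y h
    obtain ⟨N, hN0, hN⟩ := key
    refine ⟨N, hN0, ?_⟩
    funext y
    simp only [Pi.smul_apply, Pi.zero_apply]
    split_ifs with h
    · rw [← map_nsmul, hN, map_zero]
    · exact smul_zero _
  · simp only [hx, dif_pos]
    exact fun h => hc' (qToT_inj _ h)

lemma exists_dual {R : Type u} [AddCommGroup R] (A P : Finset R)
    (hP : ∀ x ∈ P, x ∈ AddSubgroup.closure (A : Set R)) (Q : Finset (R → TT))
    (hQ : ∀ q ∈ Q, ∀ y ∈ AddSubgroup.closure (A : Set R),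
      ∀ z ∈ AddSubgroup.closure (A : Set R), q (y + z) = q y + q z)
    (hQt : ∀ q ∈ Q, ∃ N : ℕ, N ≠ 0 ∧ N • q = 0) :
    ∃ D, IsDual (AddSubgroup.closure (A : Set R)) P D ∧ Q ⊆ D := by
  classical
  set G := AddSubgroup.closure (A : Set R) with hG
  have h1 : ∀ x : R, ∃ q : R → TT, (∀ y ∈ G, ∀ z ∈ G, q (y + z) = q y + q z) ∧
      (∃ N : ℕ, N ≠ 0 ∧ N • q = 0) ∧ (x ∈ P → x ≠ 0 → q x ≠ 0) := by
    intro x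
    by_cases hx : x ∈ P ∧ x ≠ 0
    · obtain ⟨q, h1, h2, h3⟩ := exists_sep_function A x (hP x hx.1) hx.2
      exact ⟨q, h1, h2, fun _ _ => h3⟩
    · refine ⟨0, by simp, ⟨1, one_ne_zero, by simp⟩, fun a b => absurd ⟨a, b⟩ hx⟩
  choose q hq1 hq2 hq3 using h1
  let B : Finset (R → TT) := Q ∪ P.image q
  have hBadd : ∀ χ ∈ B, ∀ y ∈ G, ∀ z ∈ G, χ (y + z) = χ y + χ z := by
    intro χ hχ
    rcases Finset.mem_union.1 hχ with h | h
    · exact hQ χ h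
    · obtain ⟨x, -, rfl⟩ := Finset.mem_image.1 h
      exact hq1 x
  have hBt : ∀ χ ∈ B, ∃ N : ℕ, N ≠ 0 ∧ N • χ = 0 := by
    intro χ hχ
    rcases Finset.mem_union.1 hχ with h | h
    · exact hQt χ h
    · obtain ⟨x, -, rfl⟩ := Finset.mem_image.1 h
      exact hq2 x
  let H := AddSubgroup.closure (B : Set (R → TT))
  have hHt : ∀ χ ∈ H, ∃ N : ℕ, N ≠ 0 ∧ N • χ = 0 := by
    intro χ hχ
    induction hχ using AddSubgroup.closure_induction with
    | mem a ha => exact hBt a ha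
    | zero => exact ⟨1, one_ne_zero, by simp⟩
    | add a b _ _ iha ihb =>
      obtain ⟨N, hN, hN'⟩ := iha
      obtain ⟨M, hM, hM'⟩ := ihb
      refine ⟨N * M, mul_ne_zero hN hM, ?_⟩
      rw [smul_add, mul_smul, mul_smul, hM', smul_zero, smul_comm, hN', smul_zero, add_zero]
    | neg a _ iha =>
      obtain ⟨N, hN, hN'⟩ := iha
      exact ⟨N, hN, by rw [smul_neg, hN', neg_zero]⟩
  have hfg : AddGroup.FG H := by
    rw [AddGroup.fg_iff_addSubgroup_fg]
    exact ⟨B, rfl⟩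
  have hfin : Finite H := by
    refine AddCommGroup.finite_of_fg_isAddTorsion H ?_
    rintro ⟨χ, hχ⟩
    obtain ⟨N, hN, hN'⟩ := hHt χ hχ
    rw [isOfFinAddOrder_iff_nsmul_eq_zero]
    exact ⟨N, Nat.pos_of_ne_zero hN, Subtype.ext hN'⟩
  have hfin' : (H : Set (R → TT)).Finite := hfin
  refine ⟨hfin'.toFinset, ⟨?_, ?_, ?_, ?_, hP, ?_⟩, ?_⟩
  · simp
  · intro χ hχ ψ hψ
    simp only [Set.Finite.mem_toFinset, SetLike.mem_coe] at *
    exact sub_mem hχ hψ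
  · intro χ hχ
    simp only [Set.Finite.mem_toFinset, SetLike.mem_coe] at hχ
    induction hχ using AddSubgroup.closure_induction with
    | mem a ha => exact hBadd a ha
    | zero => simp
    | add a b _ _ iha ihb =>
      intro x hx y hy
      simp only [Pi.add_apply, iha x hx y hy, ihb x hx y hy]
      abel
    | neg a _ iha =>
      intro x hx y hy
      simp only [Pi.neg_apply, iha x hx y hy]
      abel
  · intro x hx hx0
    refine ⟨q x, ?_, hq3 x hx hx0⟩
    simp only [Set.Finite.mem_toFinset, SetLike.mem_coe]
    exact AddSubgroup.subset_closure (Finset.mem_coe.2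
      (Finset.mem_union_right _ (Finset.mem_image_of_mem _ hx)))
  · intro χ hχ
    simp only [Set.Finite.mem_toFinset, SetLike.mem_coe] at hχ
    exact hHt χ hχ
  · intro χ hχ
    simp only [Set.Finite.mem_toFinset, SetLike.mem_coe]
    exact AddSubgroup.subset_closure (Finset.mem_coe.2 (Finset.mem_union_left _ hχ))

namespace IsDual

variable {R : Type u} [AddCommGroup R] {G : AddSubgroup R} {P : Finset R} {D : Finset (R → TT)}

lemma neg (h : IsDual G P D) {χ : R → TT} (hχ : χ ∈ D) : -χ ∈ D := by
  have := h.sub 0 h.zero χ hχ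
  simpa using this

lemma add (h : IsDual G P D) {χ ψ : R → TT} (hχ : χ ∈ D) (hψ : ψ ∈ D) : χ + ψ ∈ D := by
  have := h.sub χ hχ _ (h.neg hψ)
  simpa using this

lemma map_zero (h : IsDual G P D) {χ : R → TT} (hχ : χ ∈ D) : χ 0 = 0 := by
  have := h.hadd χ hχ 0 (zero_mem G) 0 (zero_mem G)
  simpa using this

lemma map_neg (h : IsDual G P D) {χ : R → TT} (hχ : χ ∈ D) {x : R} (hx : x ∈ G) :
    χ (-x) = -χ x := by
  have := h.hadd χ hχ x hx (-x) (neg_mem hx)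
  rw [add_neg_cancel, h.map_zero hχ] at this
  exact (neg_eq_of_add_eq_zero_right this.symm).symm

lemma map_sub (h : IsDual G P D) {χ : R → TT} (hχ : χ ∈ D) {x y : R} (hx : x ∈ G) (hy : y ∈ G) :
    χ (x - y) = χ x - χ y := by
  rw [sub_eq_add_neg, h.hadd χ hχ x hx (-y) (neg_mem hy), h.map_neg hχ hy, sub_eq_add_neg]

lemma card_pos (h : IsDual G P D) : (0 : ℝ) < D.card := by
  exact_mod_cast Finset.card_pos.2 ⟨0, h.zero⟩

lemma orth_zero (h : IsDual G P D) : ∑ χ ∈ D, ee (χ 0) = D.card := by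
  rw [Finset.sum_congr rfl (fun χ hχ => by rw [h.map_zero hχ, ee_zero])]
  simp

lemma orth_ne (h : IsDual G P D) {x : R} (hx : x ∈ P) (hx0 : x ≠ 0) :
    ∑ χ ∈ D, ee (χ x) = 0 := by
  obtain ⟨ψ, hψ, hψx⟩ := h.sep x hx hx0
  have h1 : ∑ χ ∈ D, ee (χ x) = ∑ χ ∈ D, ee ((χ + ψ) x) := by
    symm
    refine Finset.sum_bij (fun χ _ => χ + ψ) (fun χ hχ => h.add hχ hψ) ?_ ?_ ?_
    · intro a _ b _ hab
      exact add_right_cancel hab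
    · intro b hb
      exact ⟨b - ψ, h.sub b hb ψ hψ, by simp⟩
    · intro a _
      rfl
  have h2 : ∑ χ ∈ D, ee ((χ + ψ) x) = (∑ χ ∈ D, ee (χ x)) * ee (ψ x) := by
    rw [Finset.sum_mul]
    refine Finset.sum_congr rfl (fun χ _ => ?_)
    rw [Pi.add_apply, ee_add]
  rw [h2] at h1
  have h3 : (∑ χ ∈ D, ee (χ x)) * (ee (ψ x) - 1) = 0 := by
    rw [mul_sub, mul_one, ← h1, sub_self]
  rcases mul_eq_zero.1 h3 with h4 | h4
  · exact h4
  · exact absurd (sub_eq_zero.1 h4) (ee_ne_one hψx)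

end IsDual

end DualGroup

section SumN

open scoped Classical

/-- The `n`-fold sumset. -/
noncomputable def sumN {R : Type u} [AddCommGroup R] (Y : Finset R) : ℕ → Finset R
  | 0 => {0}
  | n + 1 => sumN Y n + Y

variable {R : Type u} [AddCommGroup R]

lemma sumN_zero (Y : Finset R) : sumN Y 0 = {0} := rfl

lemma sumN_succ (Y : Finset R) (n : ℕ) : sumN Y (n + 1) = sumN Y n + Y := rfl

lemma sumN_one (Y : Finset R) : sumN Y 1 = Y := by
  rw [sumN_succ, sumN_zero, Finset.singleton_zero, zero_add]

lemma sumN_add (Y : Finset R) (m n : ℕ) : sumN Y (m + n) = sumN Y m + sumN Y n := by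
  induction n with
  | zero => rw [add_zero, sumN_zero, Finset.singleton_zero, add_zero]
  | succ n ih => rw [← add_assoc, sumN_succ, sumN_succ, ih, add_assoc]

lemma sumN_two (Y : Finset R) : sumN Y 2 = Y + Y := by
  rw [sumN_succ, sumN_one]

lemma zero_mem_sumN {Y : Finset R} (h0 : 0 ∈ Y) (n : ℕ) : 0 ∈ sumN Y n := by
  induction n with
  | zero => simp [sumN_zero]
  | succ n ih => rw [sumN_succ]; exact Finset.mem_add.2 ⟨0, ih, 0, h0, by simp⟩

lemma sumN_mono {Y : Finset R} (h0 : 0 ∈ Y) {m n : ℕ} (h : m ≤ n) : sumN Y m ⊆ sumN Y n := by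
  obtain ⟨k, rfl⟩ := Nat.exists_eq_add_of_le h
  rw [sumN_add]
  intro x hx
  exact Finset.mem_add.2 ⟨x, hx, 0, zero_mem_sumN h0 k, by simp⟩

lemma sumN_subset {Y Y' : Finset R} (h : Y ⊆ Y') (n : ℕ) : sumN Y n ⊆ sumN Y' n := by
  induction n with
  | zero => exact subset_rfl
  | succ n ih => rw [sumN_succ, sumN_succ]; exact Finset.add_subset_add ih h

lemma add_mem_sumN {Y : Finset R} {m n : ℕ} {x y : R} (hx : x ∈ sumN Y m) (hy : y ∈ sumN Y n) :
    x + y ∈ sumN Y (m + n) := by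
  rw [sumN_add]; exact Finset.add_mem_add hx hy

lemma neg_mem_sumN {Y : Finset R} (hs : ∀ y ∈ Y, -y ∈ Y) {n : ℕ} {x : R} (hx : x ∈ sumN Y n) :
    -x ∈ sumN Y n := by
  induction n generalizing x with
  | zero => simp [sumN_zero] at hx ⊢; exact hx
  | succ n ih =>
    rw [sumN_succ] at hx ⊢
    obtain ⟨a, ha, b, hb, rfl⟩ := Finset.mem_add.1 hx
    rw [neg_add]
    exact Finset.add_mem_add (ih ha) (hs b hb)

lemma sumN_subset_addSubgroup {Y : Finset R} {G : AddSubgroup R} (h : ∀ y ∈ Y, y ∈ G) (n : ℕ) :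
    ∀ x ∈ sumN Y n, x ∈ G := by
  induction n with
  | zero => intro x hx; simp [sumN_zero] at hx; rw [hx]; exact zero_mem G
  | succ n ih =>
    intro x hx
    rw [sumN_succ] at hx
    obtain ⟨a, ha, b, hb, rfl⟩ := Finset.mem_add.1 hx
    exact add_mem (ih a ha) (h b hb)

lemma card_sumN_le (F : Finset R) (n : ℕ) : (sumN F n).card ≤ (n + 1) ^ F.card := by
  have key : ∀ x ∈ sumN F n, ∃ m : F → ℕ, (∀ f, m f ≤ n) ∧ ∑ f : F, m f • (f : R) = x := by
    induction n with
    | zero =>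
      intro x hx
      simp [sumN_zero] at hx
      exact ⟨fun _ => 0, by simp, by simp [hx]⟩
    | succ n ih =>
      intro x hx
      rw [sumN_succ] at hx
      obtain ⟨a, ha, b, hb, rfl⟩ := Finset.mem_add.1 hx
      obtain ⟨m, hm, rfl⟩ := ih a ha
      refine ⟨fun f => m f + if f = ⟨b, hb⟩ then 1 else 0, ?_, ?_⟩
      · intro f
        have := hm f
        beta_reduce
        split_ifs <;> omega
      · simp [add_smul, Finset.sum_add_distrib, ite_smul]
  have hsub : sumN F n ⊆ (Fintype.piFinset (fun _ : F => Finset.range (n + 1))).image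
      (fun m => ∑ f : F, m f • (f : R)) := by
    intro x hx
    obtain ⟨m, hm, rfl⟩ := key x hx
    refine Finset.mem_image_of_mem _ ?_
    rw [Fintype.mem_piFinset]
    intro f
    exact Finset.mem_range.2 (Nat.lt_succ_of_le (hm f))
  calc (sumN F n).card ≤ _ := Finset.card_le_card hsub
    _ ≤ _ := Finset.card_image_le
    _ = (n + 1) ^ F.card := by simp

lemma sumN_cover {Y F : Finset R} (h : Y + Y ⊆ F + Y) (n : ℕ) :
    sumN Y (n + 1) ⊆ sumN F n + Y := by
  induction n with
  | zero => rw [sumN_succ, sumN_zero, sumN_zero]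
  | succ n ih =>
    rw [sumN_succ]
    calc sumN Y (n + 1) + Y ⊆ sumN F n + Y + Y := Finset.add_subset_add_right ih
      _ = sumN F n + (Y + Y) := add_assoc _ _ _
      _ ⊆ sumN F n + (F + Y) := Finset.add_subset_add_left h
      _ = sumN F (n + 1) + Y := by rw [sumN_succ, add_assoc]

lemma card_sumN_growth {Y F : Finset R} {L : ℕ} (h : Y + Y ⊆ F + Y) (hF : F.card ≤ L) {n : ℕ}
    (hn : 1 ≤ n) : (sumN Y n).card ≤ n ^ L * Y.card := by
  obtain ⟨k, rfl⟩ := Nat.exists_eq_add_of_le' hn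
  calc (sumN Y (k + 1)).card ≤ (sumN F k + Y).card := Finset.card_le_card (sumN_cover h k)
    _ ≤ (sumN F k).card * Y.card := Finset.card_add_le
    _ ≤ (k + 1) ^ F.card * Y.card := Nat.mul_le_mul_right _ (card_sumN_le F k)
    _ ≤ (k + 1) ^ L * Y.card := Nat.mul_le_mul_right _ (Nat.pow_le_pow_right (by omega) hF)

lemma growth_pigeonhole (L : ℕ) (η : ℝ) (hη : 0 < η) : ∃ nmax : ℕ, ∀ a : ℕ → ℝ, Monotone a →
    0 < a 1 → (∀ n, 1 ≤ n → a n ≤ (n : ℝ) ^ L * a 1) →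
    ∃ n, 1 ≤ n ∧ n ≤ nmax ∧ a (n + 1) ≤ (1 + η) * a n ∧ a (2 * n) ≤ 16 ^ L * a n := by
  obtain ⟨j0, hj0⟩ := pow_unbounded_of_one_lt ((16 : ℝ) ^ L) (show (1 : ℝ) < 1 + η by linarith)
  refine ⟨2 * 4 ^ (2 * j0 + 1), fun a ha ha1 hgr => ?_⟩
  have hpos : ∀ n, 1 ≤ n → 0 < a n := fun n hn => ha1.trans_le (ha hn)
  have step1 : ∃ j, j0 ≤ j ∧ j ≤ 2 * j0 ∧ a (4 * 4 ^ j) ≤ 16 ^ L * a (4 ^ j) := by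
    by_contra! hcon
    have h1 : ∀ i, i ≤ j0 + 1 → (16 ^ L) ^ i * a (4 ^ j0) ≤ a (4 ^ (j0 + i)) := by
      intro i hi
      induction i with
      | zero => simp
      | succ i ih =>
        have h2 := ih (by omega)
        have h3 := (hcon (j0 + i) (by omega) (by omega)).le
        have h4 : 4 * 4 ^ (j0 + i) = 4 ^ (j0 + (i + 1)) := by ring
        rw [h4] at h3
        calc ((16 : ℝ) ^ L) ^ (i + 1) * a (4 ^ j0) = 16 ^ L * ((16 ^ L) ^ i * a (4 ^ j0)) := by ring
          _ ≤ 16 ^ L * a (4 ^ (j0 + i)) := by gcongr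
          _ ≤ _ := h3
    have h5 := h1 j0 (by omega)
    have h6 := hcon (j0 + j0) (by omega) (by omega)
    have h7 : 4 * 4 ^ (j0 + j0) = 4 ^ (2 * j0 + 1) := by ring
    rw [h7] at h6
    have h8 := hgr (4 ^ (2 * j0 + 1)) (by
      exact Nat.one_le_pow _ _ (by norm_num))
    have h9 : a 1 ≤ a (4 ^ j0) := ha (Nat.one_le_pow _ _ (by norm_num))
    have h10 : (((4 : ℕ) ^ (2 * j0 + 1) : ℕ) : ℝ) ^ L ≤ 16 ^ L * (16 ^ L) ^ j0 := by
      push_cast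
      rw [← pow_mul, ← pow_mul, ← pow_add]
      have : (16 : ℝ) = 4 ^ 2 := by norm_num
      rw [this, ← pow_mul]
      apply pow_le_pow_right₀ (by norm_num)
      nlinarith
    have h11 : (16 : ℝ) ^ L * ((16 ^ L) ^ j0 * a 1) ≤ 16 ^ L * a (4 ^ (j0 + j0)) := by
      gcongr
      refine le_trans ?_ h5
      gcongr
    have h12 : (((4 : ℕ) ^ (2 * j0 + 1) : ℕ) : ℝ) ^ L * a 1 ≤ 16 ^ L * (16 ^ L) ^ j0 * a 1 := by
      gcongr
    nlinarith
  obtain ⟨j, hj1, hj2, hj⟩ := step1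
  have hN1 : 1 ≤ 4 ^ j := Nat.one_le_pow _ _ (by norm_num)
  have hNm : 4 ^ j ≤ 4 ^ (2 * j0 + 1) := Nat.pow_le_pow_right (by norm_num) (by omega)
  have hNj : j0 ≤ 4 ^ j := hj1.trans (Nat.lt_pow_self (by norm_num)).le
  generalize 4 ^ j = N at *
  have step2 : ∃ n, N ≤ n ∧ n < 2 * N ∧ a (n + 1) ≤ (1 + η) * a n := by
    by_contra! hcon
    have h1 : ∀ i, i ≤ N → (1 + η) ^ i * a N ≤ a (N + i) := by
      intro i hi
      induction i with
      | zero => simp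
      | succ i ih =>
        have h2 := ih (by omega)
        have h3 := (hcon (N + i) (by omega) (by omega)).le
        calc (1 + η) ^ (i + 1) * a N = (1 + η) * ((1 + η) ^ i * a N) := by ring
          _ ≤ (1 + η) * a (N + i) := by gcongr
          _ ≤ _ := h3
    have h4 := h1 N le_rfl
    have h5 : (1 + η) ^ j0 ≤ (1 + η) ^ N := pow_le_pow_right₀ (by linarith) hNj
    have h6 : a (N + N) ≤ a (4 * N) := ha (by omega)
    have h7 := hpos N hN1
    nlinarith
  obtain ⟨n, hn1, hn2, hn⟩ := step2
  refine ⟨n, by omega, by omega, hn, ?_⟩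
  calc a (2 * n) ≤ a (4 * N) := ha (by omega)
    _ ≤ 16 ^ L * a N := hj
    _ ≤ 16 ^ L * a n := by
      have := ha hn1
      gcongr

end SumN

section Fourier

open scoped Classical

/-- Fourier transform of the indicator function of `A`. -/
noncomputable def ft {R : Type u} (A : Finset R) (χ : R → TT) : ℂ := ∑ x ∈ A, ee (χ x)

lemma norm_ft_le {R : Type u} (A : Finset R) (χ : R → TT) : ‖ft A χ‖ ≤ A.card := by
  refine (norm_sum_le _ _).trans ?_
  simp [norm_ee]

variable {R : Type u} [AddCommGroup R] {G : AddSubgroup R} {P : Finset R} {D : Finset (R → TT)}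

lemma IsDual.orth_sum (h : IsDual G P D) {ι : Type*} (T : Finset ι) (g : ι → R)
    (hg : ∀ t ∈ T, g t ∈ P) :
    ∑ χ ∈ D, ∑ t ∈ T, ee (χ (g t)) = (D.card : ℂ) * (T.filter (fun t => g t = 0)).card := by
  rw [Finset.sum_comm]
  have : ∀ t ∈ T, ∑ χ ∈ D, ee (χ (g t)) = if g t = 0 then (D.card : ℂ) else 0 := by
    intro t ht
    split_ifs with h0
    · rw [h0, h.orth_zero]
    · exact h.orth_ne (hg t ht) h0
  rw [Finset.sum_congr rfl this, ← Finset.sum_filter, Finset.sum_const, nsmul_eq_mul, mul_comm]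

lemma IsDual.ft_normSq (h : IsDual G P D) {A : Finset R} (hA : ∀ x ∈ A, x ∈ G) {χ : R → TT}
    (hχ : χ ∈ D) : ((‖ft A χ‖ ^ 2 : ℝ) : ℂ) = ∑ p ∈ A ×ˢ A, ee (χ (p.1 - p.2)) := by
  rw [Complex.ofReal_pow, ← Complex.mul_conj', ft, map_sum, Finset.sum_mul_sum,
    Finset.sum_product]
  refine Finset.sum_congr rfl fun x hx => Finset.sum_congr rfl fun y hy => ?_
  rw [h.map_sub hχ (hA x hx) (hA y hy), ee_sub]

lemma IsDual.parseval (h : IsDual G P D) {A : Finset R} (hA : ∀ x ∈ A, x ∈ G)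
    (hP : ∀ x ∈ A, ∀ y ∈ A, x - y ∈ P) : ∑ χ ∈ D, ‖ft A χ‖ ^ 2 = (D.card : ℝ) * A.card := by
  have h1 : ((∑ χ ∈ D, ‖ft A χ‖ ^ 2 : ℝ) : ℂ) = (((D.card : ℝ) * A.card : ℝ) : ℂ) := by
    rw [Complex.ofReal_sum, Finset.sum_congr rfl (fun χ hχ => h.ft_normSq hA hχ),
      h.orth_sum (A ×ˢ A) (fun p => p.1 - p.2) (fun p hp =>
        hP _ (Finset.mem_product.1 hp).1 _ (Finset.mem_product.1 hp).2)]
    have : (A ×ˢ A).filter (fun p => p.1 - p.2 = 0) = A.image (fun a => (a, a)) := by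
      ext ⟨a, b⟩
      simp only [Finset.mem_filter, Finset.mem_product, Finset.mem_image, sub_eq_zero,
        Prod.mk.injEq]
      constructor
      · rintro ⟨⟨h1, h2⟩, h3⟩
        exact ⟨a, h1, rfl, h3⟩
      · rintro ⟨c, hc, rfl, rfl⟩
        exact ⟨⟨hc, hc⟩, rfl⟩
    rw [this, Finset.card_image_of_injective _ (fun a b hab => (Prod.mk.inj hab).1)]
    push_cast
    rfl
  exact Complex.ofReal_injective h1

lemma IsDual.energy (h : IsDual G P D) {A : Finset R} (hA : ∀ x ∈ A, x ∈ G)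
    (hP : ∀ x ∈ A, ∀ y ∈ A, ∀ z ∈ A, ∀ w ∈ A, x - y + (z - w) ∈ P) :
    ∑ χ ∈ D, ‖ft A χ‖ ^ 4 = (D.card : ℝ) * Finset.addEnergy A A := by
  have h1 : ((∑ χ ∈ D, ‖ft A χ‖ ^ 4 : ℝ) : ℂ) =
      (((D.card : ℝ) * Finset.addEnergy A A : ℝ) : ℂ) := by
    have h2 : ∀ χ ∈ D, ((‖ft A χ‖ ^ 4 : ℝ) : ℂ) =
        ∑ q ∈ (A ×ˢ A) ×ˢ (A ×ˢ A), ee (χ (q.1.1 - q.1.2 + (q.2.1 - q.2.2))) := by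
      intro χ hχ
      have : ‖ft A χ‖ ^ 4 = ‖ft A χ‖ ^ 2 * ‖ft A χ‖ ^ 2 := by ring
      rw [this, Complex.ofReal_mul, h.ft_normSq hA hχ, Finset.sum_mul_sum,
        Finset.sum_product (A ×ˢ A) (A ×ˢ A)]
      refine Finset.sum_congr rfl fun x hx => Finset.sum_congr rfl fun y hy => ?_
      rw [Finset.mem_product] at hx hy
      rw [h.hadd χ hχ _ (sub_mem (hA _ hx.1) (hA _ hx.2)) _ (sub_mem (hA _ hy.1) (hA _ hy.2)),
        ee_add]
    rw [Complex.ofReal_sum, Finset.sum_congr rfl h2,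
      h.orth_sum ((A ×ˢ A) ×ˢ (A ×ˢ A)) (fun q => q.1.1 - q.1.2 + (q.2.1 - q.2.2)) (fun q hq => by
      simp only [Finset.mem_product] at hq
      exact hP _ hq.1.1 _ hq.1.2 _ hq.2.1 _ hq.2.2)]
    rw [Finset.addEnergy]
    push_cast
    congr 2
    congr 1
    ext ⟨⟨a, b⟩, ⟨c, d⟩⟩
    simp only [Finset.mem_filter]
    refine and_congr Iff.rfl ?_
    constructor
    · intro h
      have : a + c - (b + d) = 0 := by rw [← h]; abel
      exact sub_eq_zero.1 this
    · intro h
      have : a + c - (b + d) = 0 := sub_eq_zero.2 h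
      rw [← this]; abel
  exact Complex.ofReal_injective h1

/-- Characters in the large spectrum of a set with small growth are almost trivial on `Y`. -/
lemma IsDual.spec_small (h : IsDual G P D) {A Y : Finset R} (hA : ∀ x ∈ A, x ∈ G)
    (hY : ∀ x ∈ Y, x ∈ G) (h0 : 0 ∈ Y) {η β : ℝ} (hβ : 0 < β) (hA0 : A.Nonempty)
    (hgr : ((A + Y).card : ℝ) ≤ (1 + η) * A.card) {χ : R → TT} (hχ : χ ∈ D)
    (hspec : β * A.card ≤ ‖ft A χ‖) {y : R} (hy : y ∈ Y) : ‖χ y‖ ≤ 2 * η / β := by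
  have hA1 : (0 : ℝ) < A.card := by exact_mod_cast hA0.card_pos
  set B := A.image (fun x => x + y) with hB
  have hBcard : B.card = A.card := Finset.card_image_of_injective _ (add_left_injective y)
  have h1 : ∑ x ∈ B, ee (χ x) = ft A χ * ee (χ y) := by
    rw [hB, Finset.sum_image (fun a _ b _ hab => add_right_cancel hab), ft, Finset.sum_mul]
    refine Finset.sum_congr rfl fun x hx => ?_
    rw [h.hadd χ hχ x (hA x hx) y (hY y hy), ee_add]
  have h2 : ft A χ * (ee (χ y) - 1) = ∑ x ∈ B \ A, ee (χ x) - ∑ x ∈ A \ B, ee (χ x) := by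
    rw [mul_sub, mul_one, ← h1, ft, Finset.sum_sdiff_sub_sum_sdiff]
  have hun : ((A ∪ B).card : ℝ) ≤ (1 + η) * A.card := by
    refine le_trans ?_ hgr
    exact_mod_cast Finset.card_le_card (by
      intro x hx
      rcases Finset.mem_union.1 hx with hx | hx
      · exact Finset.mem_add.2 ⟨x, hx, 0, h0, add_zero x⟩
      · obtain ⟨a, ha, rfl⟩ := Finset.mem_image.1 hx
        exact Finset.add_mem_add ha hy)
  have hc1 : ((B \ A).card : ℝ) + A.card = (A ∪ B).card := by
    rw [Finset.union_comm]
    exact_mod_cast Finset.card_sdiff_add_card B A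
  have hc2 : ((A \ B).card : ℝ) + B.card = (A ∪ B).card := by
    exact_mod_cast Finset.card_sdiff_add_card A B
  have h3 : ‖ft A χ‖ * ‖ee (χ y) - 1‖ ≤ 2 * η * A.card := by
    rw [← norm_mul, h2]
    have e1 : ‖∑ x ∈ B \ A, ee (χ x)‖ ≤ (B \ A).card := norm_ft_le _ _
    have e2 : ‖∑ x ∈ A \ B, ee (χ x)‖ ≤ (A \ B).card := norm_ft_le _ _
    have e3 := norm_sub_le (∑ x ∈ B \ A, ee (χ x)) (∑ x ∈ A \ B, ee (χ x))
    rw [hBcard] at hc2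
    linarith
  have h4 := le_norm_ee_sub_one (χ y)
  rw [le_div_iff₀ hβ]
  have h5 : β * A.card * ‖χ y‖ ≤ ‖ft A χ‖ * ‖ee (χ y) - 1‖ :=
    mul_le_mul hspec h4 (norm_nonneg _) (norm_nonneg _)
  have h6 : β * A.card * ‖χ y‖ ≤ 2 * η * A.card := h5.trans h3
  have h7 : (‖χ y‖ * β) * A.card ≤ (2 * η) * A.card := by linarith
  exact le_of_mul_le_mul_right h7 hA1

/-- Lower bound for the size of the large spectrum of a set of small doubling. -/
lemma IsDual.spec_card (h : IsDual G P D) {A : Finset R} (hA : ∀ x ∈ A, x ∈ G)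
    (hA0 : A.Nonempty) (hP2 : ∀ x ∈ A, ∀ y ∈ A, x - y ∈ P)
    (hP : ∀ x ∈ A, ∀ y ∈ A, ∀ z ∈ A, ∀ w ∈ A, x - y + (z - w) ∈ P) {K β : ℝ} (hK : 0 < K)
    (hβK : 2 * K * β ^ 2 ≤ 1) (hdbl : ((A + A).card : ℝ) ≤ K * A.card) :
    (D.card : ℝ) ≤ 2 * K * A.card * (D.filter (fun χ => β * A.card ≤ ‖ft A χ‖)).card := by
  have hA1 : (0 : ℝ) < A.card := by exact_mod_cast hA0.card_pos
  have hD := h.card_pos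
  have hE : ((A.card : ℝ) ^ 2 * (A.card : ℝ) ^ 2) ≤ (A + A).card * Finset.addEnergy A A := by
    exact_mod_cast Finset.le_card_add_mul_addEnergy A A
  have hE0 : (0 : ℝ) ≤ Finset.addEnergy A A := Nat.cast_nonneg _
  have hE2 : (A.card : ℝ) ^ 3 ≤ K * Finset.addEnergy A A := by
    have : (A.card : ℝ) ^ 3 * A.card ≤ (K * Finset.addEnergy A A) * A.card := by
      calc (A.card : ℝ) ^ 3 * A.card = (A.card : ℝ) ^ 2 * (A.card : ℝ) ^ 2 := by ring
        _ ≤ ((A + A).card : ℝ) * Finset.addEnergy A A := hE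
        _ ≤ (K * A.card) * Finset.addEnergy A A := by gcongr
        _ = _ := by ring
    exact le_of_mul_le_mul_right this hA1
  have hen := h.energy hA hP
  have hpa := h.parseval hA hP2
  set S := D.filter (fun χ => β * A.card ≤ ‖ft A χ‖) with hS
  have hsplit := Finset.sum_filter_add_sum_filter_not D (fun χ => β * A.card ≤ ‖ft A χ‖)
    (fun χ => ‖ft A χ‖ ^ 4)
  have h1 : ∑ χ ∈ S, ‖ft A χ‖ ^ 4 ≤ S.card * (A.card : ℝ) ^ 4 := by
    rw [← nsmul_eq_mul]
    refine Finset.sum_le_card_nsmul _ _ _ fun χ _ => ?_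
    gcongr
    exact norm_ft_le A χ
  have h2 : ∑ χ ∈ D.filter (fun χ => ¬ β * A.card ≤ ‖ft A χ‖), ‖ft A χ‖ ^ 4 ≤
      (β * A.card) ^ 2 * ((D.card : ℝ) * A.card) := by
    rw [← hpa, Finset.mul_sum]
    refine (Finset.sum_le_sum (g := fun χ => (β * A.card) ^ 2 * ‖ft A χ‖ ^ 2) fun χ hχ => ?_).trans
      (Finset.sum_le_sum_of_subset_of_nonneg (Finset.filter_subset _ _)
        fun χ _ _ => by positivity)
    have h3 := (not_le.1 (Finset.mem_filter.1 hχ).2).le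
    have : ‖ft A χ‖ ^ 4 = ‖ft A χ‖ ^ 2 * ‖ft A χ‖ ^ 2 := by ring
    rw [this]
    gcongr
  have h3 : (D.card : ℝ) * (A.card : ℝ) ^ 3 ≤ K * (S.card * (A.card : ℝ) ^ 4 +
      (β * A.card) ^ 2 * ((D.card : ℝ) * A.card)) := by
    calc (D.card : ℝ) * (A.card : ℝ) ^ 3 ≤ D.card * (K * Finset.addEnergy A A) := by gcongr
      _ = K * ∑ χ ∈ D, ‖ft A χ‖ ^ 4 := by rw [hen]; ring
      _ ≤ _ := by
        gcongr
        rw [← hsplit]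
        exact add_le_add h1 h2
  have h4 : (2 * K * β ^ 2) * ((D.card : ℝ) * (A.card : ℝ) ^ 3) ≤
      1 * ((D.card : ℝ) * (A.card : ℝ) ^ 3) := by gcongr
  have h5 : (D.card : ℝ) * (A.card : ℝ) ^ 3 ≤ (2 * K * A.card * S.card) * (A.card : ℝ) ^ 3 := by
    nlinarith
  exact le_of_mul_le_mul_right h5 (by positivity)

/-- The key Fourier lemma: an approximate group has many almost trivial characters. -/
lemma many_small_characters (L : ℕ) (ε : ℝ) (hε : 0 < ε) : ∃ c : ℝ, 0 < c ∧ ∃ m : ℕ,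
    ∀ (R : Type u) [AddCommGroup R] (G : AddSubgroup R) (P : Finset R) (D : Finset (R → TT))
      (Y F : Finset R), IsDual G P D → 0 ∈ Y → (∀ y ∈ Y, -y ∈ Y) → (∀ y ∈ Y, y ∈ G) →
      Y + Y ⊆ F + Y → F.card ≤ L → sumN Y m ⊆ P →
      c * D.card ≤ Y.card * (D.filter (fun χ => ∀ y ∈ Y, ‖χ y‖ ≤ ε)).card := by
  set K' : ℝ := 16 ^ L with hK'
  have hK0 : 0 < K' := by positivity
  have hK1 : 1 ≤ K' := one_le_pow₀ (by norm_num)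
  set β : ℝ := 1 / (2 * K') with hβ
  have hβ0 : 0 < β := by positivity
  have hβK : 2 * K' * β ^ 2 ≤ 1 := by
    have : 2 * K' * β ^ 2 = β := by rw [hβ]; field_simp
    rw [this, hβ, div_le_one (by positivity)]
    linarith
  obtain ⟨nmax, hnmax⟩ := growth_pigeonhole L (ε * β / 2) (by positivity)
  refine ⟨1 / (2 * K' * (nmax + 1 : ℝ) ^ L), by positivity, 4 * nmax, ?_⟩
  intro R _ G P D Y F hD h0 hsym hYG hYF hFL hP
  have hYpos : (0 : ℝ) < Y.card := by exact_mod_cast Finset.card_pos.2 ⟨0, h0⟩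
  obtain ⟨n, hn1, hn2, hg1, hg2⟩ := hnmax (fun n => ((sumN Y n).card : ℝ))
    (fun i j hij => by
      beta_reduce
      exact_mod_cast Finset.card_le_card (sumN_mono h0 hij))
    (by simpa [sumN_one] using hYpos)
    (fun n hn => by
      simp only [sumN_one]
      exact_mod_cast card_sumN_growth hYF hFL hn)
  set A := sumN Y n with hAdef
  have hAG : ∀ x ∈ A, x ∈ G := sumN_subset_addSubgroup hYG n
  have hA0 : A.Nonempty := ⟨0, zero_mem_sumN h0 n⟩
  have hsub2 : ∀ x ∈ A, ∀ y ∈ A, x - y ∈ sumN Y (n + n) := fun x hx y hy => by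
    rw [sub_eq_add_neg]
    exact add_mem_sumN hx (neg_mem_sumN hsym hy)
  have hP2 : ∀ x ∈ A, ∀ y ∈ A, x - y ∈ P := fun x hx y hy =>
    hP (sumN_mono h0 (by omega) (hsub2 x hx y hy))
  have hP4 : ∀ x ∈ A, ∀ y ∈ A, ∀ z ∈ A, ∀ w ∈ A, x - y + (z - w) ∈ P :=
    fun x hx y hy z hz w hw =>
      hP (sumN_mono h0 (by omega) (add_mem_sumN (hsub2 x hx y hy) (hsub2 z hz w hw)))
  have hdbl : ((A + A).card : ℝ) ≤ K' * A.card := by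
    rw [hAdef, ← sumN_add, ← two_mul]
    exact hg2
  have h1 := hD.spec_card hAG hA0 hP2 hP4 hK0 hβK hdbl
  have hsubset : (D.filter (fun χ => β * A.card ≤ ‖ft A χ‖)) ⊆
      D.filter (fun χ => ∀ y ∈ Y, ‖χ y‖ ≤ ε) := by
    intro χ hχ
    rw [Finset.mem_filter] at hχ ⊢
    refine ⟨hχ.1, fun y hy => ?_⟩
    have := hD.spec_small hAG hYG h0 hβ0 hA0 hg1 hχ.1 hχ.2 hy
    refine this.trans (le_of_eq ?_)
    field_simp
  have h2 : ((D.filter (fun χ => β * A.card ≤ ‖ft A χ‖)).card : ℝ) ≤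
      (D.filter (fun χ => ∀ y ∈ Y, ‖χ y‖ ≤ ε)).card := by
    exact_mod_cast Finset.card_le_card hsubset
  have h3 : (A.card : ℝ) ≤ (nmax + 1 : ℝ) ^ L * Y.card := by
    have : (A.card : ℝ) ≤ (n : ℝ) ^ L * Y.card := by
      exact_mod_cast card_sumN_growth hYF hFL hn1
    refine this.trans ?_
    have : (n : ℝ) ≤ nmax := by exact_mod_cast hn2
    gcongr
    linarith
  rw [one_div, inv_mul_le_iff₀ (by positivity)]
  calc (D.card : ℝ) ≤ _ := h1
    _ ≤ 2 * K' * ((nmax + 1 : ℝ) ^ L * Y.card) *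
      (D.filter (fun χ => ∀ y ∈ Y, ‖χ y‖ ≤ ε)).card := by gcongr
    _ = _ := by ring

end Fourier

section SpectrumCover

open scoped Classical

lemma spec_cover {R : Type u} [AddCommGroup R] {G : AddSubgroup R} {P : Finset R}
    {D : Finset (R → TT)} (h : IsDual G P D) {X Y : Finset R} (hX0 : 0 ∈ X) (hXY : X ⊆ Y)
    {α ε c M : ℝ} (hα : 0 < α) (hεα : 14 * ε ≤ α) (hc : 0 < c)
    (hM : (Y.card : ℝ) ≤ M * X.card)
    (hpar : ∑ χ ∈ D, ‖ft X χ‖ ^ 2 = (D.card : ℝ) * X.card)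
    (hsm : c * D.card ≤ Y.card * (D.filter (fun χ => ∀ y ∈ Y, ‖χ y‖ ≤ ε)).card) :
    ∃ Γ : Finset (R → TT), Γ ⊆ D ∧ (Γ.card : ℝ) ≤ 4 * M / (α ^ 2 * c) ∧
      ∀ χ ∈ D, α * X.card ≤ ‖ft X χ‖ → ∃ γ ∈ Γ, ∀ y ∈ Y, ‖χ y - γ y‖ ≤ 2 * ε := by
  have hXpos : (0 : ℝ) < X.card := by exact_mod_cast Finset.card_pos.2 ⟨0, hX0⟩
  have hDpos := h.card_pos
  set S := D.filter (fun χ => α * X.card ≤ ‖ft X χ‖) with hS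
  set N := D.filter (fun χ => ∀ y ∈ Y, ‖χ y‖ ≤ ε) with hN
  set S2 := D.filter (fun χ => α / 2 * X.card ≤ ‖ft X χ‖) with hS2
  set good := S.powerset.filter (fun Γ => ∀ γ ∈ Γ, ∀ γ' ∈ Γ, (∀ y ∈ Y, ‖γ y - γ' y‖ ≤ 2 * ε) →
    γ = γ') with hgood
  have hne : good.Nonempty := ⟨∅, by simp [hgood]⟩
  obtain ⟨Γ, hΓ, hmax⟩ := Finset.exists_max_image good Finset.card hne
  rw [hgood, Finset.mem_filter, Finset.mem_powerset] at hΓ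
  obtain ⟨hΓS, hΓsep⟩ := hΓ
  have hΓD : Γ ⊆ D := hΓS.trans (Finset.filter_subset _ _)
  refine ⟨Γ, hΓD, ?_, ?_⟩
  · have hinj : Set.InjOn (fun p : (R → TT) × (R → TT) => p.1 + p.2) (Γ ×ˢ N : Finset _) := by
      rintro ⟨γ, ψ⟩ h1 ⟨γ', ψ'⟩ h2 heq
      rw [Finset.mem_coe, Finset.mem_product] at h1 h2
      simp only at h1 h2 heq
      have h3 : γ = γ' := by
        refine hΓsep γ h1.1 γ' h2.1 fun y hy => ?_
        have e1 := (Finset.mem_filter.1 h1.2).2 y hy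
        have e2 := (Finset.mem_filter.1 h2.2).2 y hy
        have e3 : γ y - γ' y = ψ' y - ψ y := by
          have := congrFun heq y
          simp only [Pi.add_apply] at this
          rw [sub_eq_sub_iff_add_eq_add, this, add_comm]
        rw [e3]
        have := norm_sub_le (ψ' y) (ψ y)
        linarith
      subst h3
      have h4 : ψ = ψ' := add_left_cancel heq
      rw [h4]
    have hsub : (Γ ×ˢ N).image (fun p : (R → TT) × (R → TT) => p.1 + p.2) ⊆ S2 := by
      intro χ hχ
      obtain ⟨⟨γ, ψ⟩, hp, rfl⟩ := Finset.mem_image.1 hχ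
      rw [Finset.mem_product] at hp
      simp only at hp ⊢
      have hγS := Finset.mem_filter.1 (hΓS hp.1)
      have hψN := Finset.mem_filter.1 hp.2
      rw [hS2, Finset.mem_filter]
      refine ⟨h.add hγS.1 hψN.1, ?_⟩
      have e1 : ‖ft X (γ + ψ) - ft X γ‖ ≤ X.card * (7 * ε) := by
        rw [ft, ft, ← Finset.sum_sub_distrib, ← nsmul_eq_mul]
        refine (norm_sum_le _ _).trans (Finset.sum_le_card_nsmul _ _ _ fun x hx => ?_)
        have : ee ((γ + ψ) x) - ee (γ x) = ee (γ x) * (ee (ψ x) - 1) := by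
          rw [Pi.add_apply, ee_add]; ring
        rw [this, norm_mul, norm_ee, one_mul]
        have e2 := norm_ee_sub_one_le (ψ x)
        have e3 := hψN.2 x (hXY hx)
        linarith
      have e2 : ‖ft X γ‖ ≤ ‖ft X (γ + ψ)‖ + ‖ft X (γ + ψ) - ft X γ‖ := by
        have := norm_sub_le (ft X (γ + ψ)) (ft X (γ + ψ) - ft X γ)
        simpa using this
      have e3 := hγS.2
      nlinarith
    have hcard : Γ.card * N.card ≤ S2.card := by
      rw [← Finset.card_product, ← Finset.card_image_of_injOn hinj]
      exact Finset.card_le_card hsub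
    have hcard' : (Γ.card : ℝ) * N.card ≤ S2.card := by exact_mod_cast hcard
    have hS2c : (S2.card : ℝ) * (α / 2 * X.card) ^ 2 ≤ D.card * X.card := by
      rw [← hpar, ← nsmul_eq_mul]
      refine (Finset.card_nsmul_le_sum S2 (fun χ => ‖ft X χ‖ ^ 2) _ fun χ hχ => ?_).trans
        (Finset.sum_le_sum_of_subset_of_nonneg (Finset.filter_subset _ _)
          fun χ _ _ => by positivity)
      have := (Finset.mem_filter.1 hχ).2
      gcongr
    have hΓ0 : (0 : ℝ) ≤ Γ.card := Nat.cast_nonneg _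
    have hN0 : (0 : ℝ) ≤ N.card := Nat.cast_nonneg _
    have h5 : c * D.card ≤ M * X.card * N.card := hsm.trans (by gcongr)
    have h6 : (Γ.card : ℝ) * (α ^ 2 * c) * (D.card * (X.card : ℝ) ^ 2)
        ≤ 4 * M * (D.card * (X.card : ℝ) ^ 2) := by
      have hM0 : 0 ≤ M := by
        by_contra hneg
        push Not at hneg
        have : M * X.card < 0 := mul_neg_of_neg_of_pos hneg hXpos
        have : (0 : ℝ) ≤ Y.card := Nat.cast_nonneg _
        linarith
      calc (Γ.card : ℝ) * (α ^ 2 * c) * (D.card * (X.card : ℝ) ^ 2)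
          = Γ.card * α ^ 2 * (X.card : ℝ) ^ 2 * (c * D.card) := by ring
        _ ≤ Γ.card * α ^ 2 * (X.card : ℝ) ^ 2 * (M * X.card * N.card) := by gcongr
        _ = 4 * M * X.card * ((Γ.card * N.card) * (α / 2 * X.card) ^ 2) := by ring
        _ ≤ 4 * M * X.card * (S2.card * (α / 2 * X.card) ^ 2) := by gcongr
        _ ≤ 4 * M * X.card * (D.card * X.card) := by gcongr
        _ = _ := by ring
    rw [le_div_iff₀ (by positivity)]
    exact le_of_mul_le_mul_right h6 (by positivity)
  · intro χ hχ hχα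
    by_contra! hcon
    have hχS : χ ∈ S := Finset.mem_filter.2 ⟨hχ, hχα⟩
    have hε : χ ∉ Γ → False := by
      intro hχΓ
      have hins : insert χ Γ ∈ good := by
        rw [hgood, Finset.mem_filter, Finset.mem_powerset]
        refine ⟨Finset.insert_subset hχS hΓS, ?_⟩
        intro γ hγ γ' hγ' hcl
        rcases Finset.mem_insert.1 hγ with g1 | g1 <;> rcases Finset.mem_insert.1 hγ' with g2 | g2
        · rw [g1, g2]
        · obtain ⟨y, hy, hy'⟩ := hcon γ' g2
          rw [g1] at hcl
          exact absurd (hcl y hy) (not_le.2 hy')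
        · obtain ⟨y, hy, hy'⟩ := hcon γ g1
          have := hcl y hy
          rw [g2, norm_sub_rev] at this
          exact absurd this (not_le.2 hy')
        · exact hΓsep γ g1 γ' g2 hcl
      have := hmax _ hins
      rw [Finset.card_insert_of_notMem hχΓ] at this
      omega
    by_cases hχΓ : χ ∈ Γ
    · have hc2 : ¬ (0 : ℝ) ≤ ε := by
        obtain ⟨y, hy, hy'⟩ := hcon χ hχΓ
        rw [sub_self, norm_zero] at hy'
        intro h0
        linarith
      -- then no character can be small, contradicting `hsm`
      have hNe : N = ∅ := by
        rw [Finset.eq_empty_iff_forall_notMem]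
        intro ψ hψ
        have := (Finset.mem_filter.1 hψ).2 0 (hXY hX0)
        exact hc2 ((norm_nonneg _).trans this)
      rw [hNe, Finset.card_empty, Nat.cast_zero, mul_zero] at hsm
      have : 0 < c * D.card := by positivity
      linarith
    · exact hε hχΓ

lemma exists_color {A : Type*} (E : Finset A) (m : ℕ) (hm : E.card ≤ m) :
    ∃ f : A → Fin (m + 1), Set.InjOn f E := by
  refine ⟨fun a => if h : a ∈ E then ⟨E.equivFin ⟨a, h⟩, by
    have := (E.equivFin ⟨a, h⟩).2; omega⟩ else 0, ?_⟩
  intro a ha b hb hab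
  simp only [Finset.mem_coe] at ha hb
  simp only [ha, hb, dif_pos, Fin.mk.injEq] at hab
  have := E.equivFin.injective (Fin.ext hab)
  exact congrArg Subtype.val this

/-- The dichotomy lemma. -/
lemma dichotomy (K : ℕ) (α ε τ : ℝ) (hα : 0 < α) (hε : 0 < ε) (hεα : 14 * ε ≤ α) (hτ : 0 < τ) :
    ∃ m : ℕ, ∀ (R : Type u) [AddCommGroup R] (X F : Finset R) (Q : R → R → TT), 0 ∈ X →
      (∀ x ∈ X, -x ∈ X) → X + X ⊆ F + X → F.card ≤ K →
      (∀ s ∈ X, ∀ x ∈ AddSubgroup.closure (X : Set R), ∀ y ∈ AddSubgroup.closure (X : Set R),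
        Q s (x + y) = Q s x + Q s y) →
      (∀ x ∈ X, ∀ s ∈ AddSubgroup.closure (X : Set R), ∀ t ∈ AddSubgroup.closure (X : Set R),
        Q (s + t) x = Q s x + Q t x) →
      (∀ s ∈ X, ∃ N : ℕ, N ≠ 0 ∧ N • Q s = 0) →
      ((X.filter (fun s => α * X.card ≤ ‖ft X (Q s)‖)).card : ℝ) ≤ τ * X.card ∨
      ∃ col : R → Fin (m + 1), ∀ s ∈ X, ∀ s' ∈ X, col s = col s' →
        ∀ x ∈ X, ‖Q s x - Q s' x‖ ≤ 8 * ε := by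
  obtain ⟨c, hc, m, hm⟩ := many_small_characters.{u} K ε hε
  set d : ℝ := 4 * 1 / (α ^ 2 * c) with hd
  have hd0 : 0 < d := by positivity
  set B : ℝ := K * (d + 1) / τ with hB
  refine ⟨⌈B⌉₊, ?_⟩
  intro R _ X F Q h0 hsym hXF hFK hQ1 hQ2 hQt
  rw [or_iff_not_imp_left]
  intro hbig
  push Not at hbig
  have hXpos : (0 : ℝ) < X.card := by exact_mod_cast Finset.card_pos.2 ⟨0, h0⟩
  set G := AddSubgroup.closure (X : Set R) with hG
  have hXG : ∀ x ∈ X, x ∈ G := fun x hx => AddSubgroup.subset_closure hx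
  obtain ⟨D, hD, hQD⟩ := exists_dual X (sumN X (m + 2)) (sumN_subset_addSubgroup hXG _)
    (X.image Q) (by
      intro q hq
      obtain ⟨s, hs, rfl⟩ := Finset.mem_image.1 hq
      exact hQ1 s hs) (by
      intro q hq
      obtain ⟨s, hs, rfl⟩ := Finset.mem_image.1 hq
      exact hQt s hs)
  have hsm := hm R G _ D X F hD h0 hsym hXG hXF hFK (sumN_mono h0 (by omega))
  have hpar := hD.parseval hXG (fun x hx y hy => by
    rw [sub_eq_add_neg]
    refine sumN_mono h0 (show 2 ≤ m + 2 by omega) ?_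
    rw [sumN_two]
    exact Finset.add_mem_add hx (hsym y hy))
  obtain ⟨Γ, hΓD, hΓc, hΓ⟩ := spec_cover hD h0 subset_rfl (M := 1) hα hεα hc (by simp) hpar hsm
  set N := X.filter (fun s => α * X.card ≤ ‖ft X (Q s)‖) with hN
  have hNX : N ⊆ X := Finset.filter_subset _ _
  let cls : (R → TT) → Finset R := fun γ => N.filter (fun s => ∀ x ∈ X, ‖Q s x - γ x‖ ≤ 2 * ε)
  have hex : ∃ γ ∈ Γ, τ * X.card ≤ (d + 1) * (cls γ).card := by
    by_contra! hcon
    have h1 : N.card ≤ ∑ γ ∈ Γ, (cls γ).card := by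
      refine (Finset.card_le_card ?_).trans Finset.card_biUnion_le
      intro s hs
      have hs' := Finset.mem_filter.1 hs
      obtain ⟨γ, hγ, hγ'⟩ := hΓ (Q s) (hQD (Finset.mem_image_of_mem _ hs'.1)) hs'.2
      exact Finset.mem_biUnion.2 ⟨γ, hγ, Finset.mem_filter.2 ⟨hs, hγ'⟩⟩
    have h2 : (N.card : ℝ) ≤ ∑ γ ∈ Γ, ((cls γ).card : ℝ) := by exact_mod_cast h1
    have h3 : ∑ γ ∈ Γ, ((cls γ).card : ℝ) ≤ Γ.card • (τ * X.card / (d + 1)) := by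
      refine Finset.sum_le_card_nsmul _ _ _ fun γ hγ => ?_
      rw [le_div_iff₀ (by positivity), mul_comm]
      exact (hcon γ hγ).le
    rw [nsmul_eq_mul] at h3
    have h4 : (Γ.card : ℝ) * (τ * X.card / (d + 1)) ≤ d * (τ * X.card / (d + 1)) := by
      gcongr
    have h5 : d * (τ * X.card / (d + 1)) ≤ τ * X.card := by
      rw [mul_div_assoc', div_le_iff₀ (by positivity)]
      have : 0 < τ * X.card := by positivity
      nlinarith
    linarith
  obtain ⟨γ, -, hγ⟩ := hex
  set N' := cls γ with hN'
  have hN'X : N' ⊆ X := (Finset.filter_subset _ _).trans hNX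
  have hN'pos : (0 : ℝ) < N'.card := by
    have : 0 < τ * X.card := by positivity
    by_contra hneg
    have h1 : (0 : ℝ) = N'.card := le_antisymm (Nat.cast_nonneg _) (not_lt.1 hneg)
    rw [← h1, mul_zero] at hγ
    linarith
  have hcov : ((X + N').card : ℝ) ≤ B * N'.card := by
    have h1 : ((X + N').card : ℝ) ≤ K * X.card := by
      have : (X + N').card ≤ K * X.card :=
        (Finset.card_le_card ((Finset.add_subset_add_left hN'X).trans hXF)).trans
          (Finset.card_add_le.trans (Nat.mul_le_mul_right _ hFK))
      exact_mod_cast this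
    refine h1.trans ?_
    rw [hB, div_mul_eq_mul_div, le_div_iff₀ hτ]
    calc (K : ℝ) * X.card * τ = K * (τ * X.card) := by ring
      _ ≤ K * ((d + 1) * N'.card) := by gcongr
      _ = _ := by ring
  obtain ⟨E, hEX, hEc, hE⟩ := Finset.ruzsa_covering_add
    (Finset.card_pos.1 (by exact_mod_cast hN'pos)) hcov
  obtain ⟨f, hf⟩ := exists_color E ⌈B⌉₊ (by
    have := hEc.trans (Nat.le_ceil B)
    exact_mod_cast this)
  have hrep : ∀ s : R, ∃ e a b : R, s ∈ X → e ∈ E ∧ a ∈ N' ∧ b ∈ N' ∧ s = e + (a - b) := by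
    intro s
    by_cases hs : s ∈ X
    · obtain ⟨e, he, ab, hab, hsum⟩ := Finset.mem_add.1 (hE hs)
      obtain ⟨a, ha, b, hb, rfl⟩ := Finset.mem_sub.1 hab
      exact ⟨e, a, b, fun _ => ⟨he, ha, hb, hsum.symm⟩⟩
    · exact ⟨0, 0, 0, fun h => absurd h hs⟩
  choose e a b hrep using hrep
  refine ⟨fun s => f (e s), ?_⟩
  intro s hs s' hs' hcol x hx
  obtain ⟨he, ha, hb, hs1⟩ := hrep s hs
  obtain ⟨he', ha', hb', hs1'⟩ := hrep s' hs'
  have hee : e s = e s' := hf he he' hcol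
  have hexp : ∀ e a b : R, e ∈ G → a ∈ G → b ∈ G → Q (e + (a - b)) x = Q e x + Q a x - Q b x := by
    intro e a b he ha hb
    have h1 := hQ2 x hx e he (a - b) (sub_mem ha hb)
    have h2 := hQ2 x hx (a - b) (sub_mem ha hb) b hb
    rw [sub_add_cancel] at h2
    rw [h1, h2]
    abel
  have hNG : ∀ y ∈ N', y ∈ G := fun y hy => hXG y (hN'X hy)
  rw [hs1, hs1', hexp _ _ _ (hXG _ (hEX he)) (hNG _ ha) (hNG _ hb),
    hexp _ _ _ (hXG _ (hEX he')) (hNG _ ha') (hNG _ hb'), hee]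
  have e1 := (Finset.mem_filter.1 ha).2 x hx
  have e2 := (Finset.mem_filter.1 hb).2 x hx
  have e3 := (Finset.mem_filter.1 ha').2 x hx
  have e4 := (Finset.mem_filter.1 hb').2 x hx
  have e5 : Q (e s') x + Q (a s) x - Q (b s) x - (Q (e s') x + Q (a s') x - Q (b s') x) =
      ((Q (a s) x - γ x) - (Q (b s) x - γ x)) - ((Q (a s') x - γ x) - (Q (b s') x - γ x)) := by
    abel
  rw [e5]
  refine (norm_sub_le _ _).trans ?_
  have e6 := norm_sub_le (Q (a s) x - γ x) (Q (b s) x - γ x)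
  have e7 := norm_sub_le (Q (a s') x - γ x) (Q (b s') x - γ x)
  linarith

end SpectrumCover

section Bogolyubov

open scoped Classical

lemma IsDual.ft_normSq_comp {R : Type u} [AddCommGroup R] {G : AddSubgroup R} {P : Finset R}
    {D : Finset (R → TT)} (h : IsDual G P D) {A : Finset R} {f : R → R}
    (hA : ∀ x ∈ A, f x ∈ G) {χ : R → TT} (hχ : χ ∈ D) :
    ((‖ft A (fun x => χ (f x))‖ ^ 2 : ℝ) : ℂ) = ∑ p ∈ A ×ˢ A, ee (χ (f p.1 - f p.2)) := by
  rw [Complex.ofReal_pow, ← Complex.mul_conj', ft, map_sum, Finset.sum_mul_sum,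
    Finset.sum_product]
  refine Finset.sum_congr rfl fun x hx => Finset.sum_congr rfl fun y hy => ?_
  rw [h.map_sub hχ (hA x hx) (hA y hy), ee_sub]

lemma IsDual.prod_sum {R : Type u} [AddCommGroup R] {G : AddSubgroup R} {P : Finset R}
    {D : Finset (R → TT)} (h : IsDual G P D) {ι κ : Type*} (S : Finset ι) (T : Finset κ)
    (f : ι → R) (g : κ → R) (hf : ∀ i ∈ S, f i ∈ G) (hg : ∀ i ∈ T, g i ∈ G)
    {χ : R → TT} (hχ : χ ∈ D) :
    (∑ i ∈ S, ee (χ (f i))) * (∑ j ∈ T, ee (χ (g j))) =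
      ∑ p ∈ S ×ˢ T, ee (χ (f p.1 + g p.2)) := by
  rw [Finset.sum_mul_sum, Finset.sum_product]
  refine Finset.sum_congr rfl fun x hx => Finset.sum_congr rfl fun y hy => ?_
  rw [h.hadd χ hχ _ (hf x hx) _ (hg y hy), ee_add]

lemma bog_support {R : Type u} [AddCommGroup R] {G : AddSubgroup R} {P : Finset R}
    {D : Finset (R → TT)} (h : IsDual G P D) {X : Finset R} (hX : ∀ x ∈ X, x ∈ G)
    {f₁ f₂ : R → R} (h₁ : ∀ x ∈ X, f₁ x ∈ G) (h₂ : ∀ x ∈ X, f₂ x ∈ G) {w : R} (hw : w ∈ G)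
    (hP : ∀ a ∈ X, ∀ a' ∈ X, ∀ b ∈ X, ∀ b' ∈ X, ∀ c ∈ X, ∀ c' ∈ X, ∀ e ∈ X, ∀ e' ∈ X,
      ((a - a') + (b - b')) + ((f₁ c - f₁ c') + (f₂ e - f₂ e')) + w ∈ P)
    (hpos : 0 < ∑ χ ∈ D, (‖ft X χ‖ ^ 4 * ‖ft X (fun x => χ (f₁ x))‖ ^ 2 *
      ‖ft X (fun x => χ (f₂ x))‖ ^ 2) * (ee (χ w)).re) :
    ∃ a ∈ X, ∃ a' ∈ X, ∃ b ∈ X, ∃ b' ∈ X, ∃ c ∈ X, ∃ c' ∈ X, ∃ e ∈ X, ∃ e' ∈ X,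
      ((a - a') + (b - b')) + ((f₁ c - f₁ c') + (f₂ e - f₂ e')) + w = 0 := by
  set T := ((X ×ˢ X) ×ˢ (X ×ˢ X)) ×ˢ ((X ×ˢ X) ×ˢ (X ×ˢ X)) with hT
  set g : ((R × R) × (R × R)) × ((R × R) × (R × R)) → R := fun q =>
    ((q.1.1.1 - q.1.1.2) + (q.1.2.1 - q.1.2.2)) +
      ((f₁ q.2.1.1 - f₁ q.2.1.2) + (f₂ q.2.2.1 - f₂ q.2.2.2)) with hg
  have hsubX : ∀ p ∈ X ×ˢ X, p.1 - p.2 ∈ G := fun p hp =>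
    sub_mem (hX _ (Finset.mem_product.1 hp).1) (hX _ (Finset.mem_product.1 hp).2)
  have hsub1 : ∀ p ∈ X ×ˢ X, f₁ p.1 - f₁ p.2 ∈ G := fun p hp =>
    sub_mem (h₁ _ (Finset.mem_product.1 hp).1) (h₁ _ (Finset.mem_product.1 hp).2)
  have hsub2 : ∀ p ∈ X ×ˢ X, f₂ p.1 - f₂ p.2 ∈ G := fun p hp =>
    sub_mem (h₂ _ (Finset.mem_product.1 hp).1) (h₂ _ (Finset.mem_product.1 hp).2)
  have hl : ∀ p ∈ (X ×ˢ X) ×ˢ (X ×ˢ X), (p.1.1 - p.1.2) + (p.2.1 - p.2.2) ∈ G := fun p hp =>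
    add_mem (hsubX _ (Finset.mem_product.1 hp).1) (hsubX _ (Finset.mem_product.1 hp).2)
  have hr : ∀ p ∈ (X ×ˢ X) ×ˢ (X ×ˢ X), (f₁ p.1.1 - f₁ p.1.2) + (f₂ p.2.1 - f₂ p.2.2) ∈ G :=
    fun p hp =>
      add_mem (hsub1 _ (Finset.mem_product.1 hp).1) (hsub2 _ (Finset.mem_product.1 hp).2)
  have hterm : ∀ χ ∈ D, (((‖ft X χ‖ ^ 4 * ‖ft X (fun x => χ (f₁ x))‖ ^ 2 *
      ‖ft X (fun x => χ (f₂ x))‖ ^ 2 : ℝ)) : ℂ) * ee (χ w) = ∑ q ∈ T, ee (χ (g q + w)) := by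
    intro χ hχ
    have e0 : ‖ft X χ‖ ^ 4 * ‖ft X (fun x => χ (f₁ x))‖ ^ 2 * ‖ft X (fun x => χ (f₂ x))‖ ^ 2 =
      (‖ft X χ‖ ^ 2 * ‖ft X χ‖ ^ 2) *
        (‖ft X (fun x => χ (f₁ x))‖ ^ 2 * ‖ft X (fun x => χ (f₂ x))‖ ^ 2) := by ring
    rw [e0, Complex.ofReal_mul, Complex.ofReal_mul, Complex.ofReal_mul, h.ft_normSq hX hχ,
      h.ft_normSq_comp h₁ hχ, h.ft_normSq_comp h₂ hχ,
      h.prod_sum (X ×ˢ X) (X ×ˢ X) (fun p => p.1 - p.2) (fun p => p.1 - p.2) hsubX hsubX hχ,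
      h.prod_sum (X ×ˢ X) (X ×ˢ X) (fun p => f₁ p.1 - f₁ p.2) (fun p => f₂ p.1 - f₂ p.2)
        hsub1 hsub2 hχ,
      h.prod_sum ((X ×ˢ X) ×ˢ (X ×ˢ X)) ((X ×ˢ X) ×ˢ (X ×ˢ X))
        (fun p => (p.1.1 - p.1.2) + (p.2.1 - p.2.2))
        (fun p => (f₁ p.1.1 - f₁ p.1.2) + (f₂ p.2.1 - f₂ p.2.2)) hl hr hχ, Finset.sum_mul]
    refine Finset.sum_congr rfl fun q hq => ?_
    rw [hT, Finset.mem_product] at hq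
    rw [h.hadd χ hχ _ (add_mem (hl _ hq.1) (hr _ hq.2)) _ hw, ee_add]
  have horth := h.orth_sum T (fun q => g q + w) (fun q hq => by
    simp only [hT, Finset.mem_product] at hq
    exact hP _ hq.1.1.1 _ hq.1.1.2 _ hq.1.2.1 _ hq.1.2.2 _ hq.2.1.1 _ hq.2.1.2 _ hq.2.2.1 _
      hq.2.2.2)
  rw [← Finset.sum_congr rfl hterm] at horth
  have hre := congrArg Complex.re horth
  rw [Complex.re_sum] at hre
  have hre2 : ∑ χ ∈ D, (‖ft X χ‖ ^ 4 * ‖ft X (fun x => χ (f₁ x))‖ ^ 2 *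
      ‖ft X (fun x => χ (f₂ x))‖ ^ 2) * (ee (χ w)).re =
      (D.card : ℝ) * (T.filter (fun q => g q + w = 0)).card := by
    have : ((D.card : ℂ) * (T.filter (fun q => g q + w = 0)).card).re =
        (D.card : ℝ) * (T.filter (fun q => g q + w = 0)).card := by
      rw [← Complex.ofReal_natCast, ← Complex.ofReal_natCast, ← Complex.ofReal_mul,
        Complex.ofReal_re]
    rw [← this, ← hre]
    refine Finset.sum_congr rfl fun χ _ => ?_
    rw [Complex.re_ofReal_mul]
  rw [hre2] at hpos
  have hne : (T.filter (fun q => g q + w = 0)).Nonempty := by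
    rw [Finset.nonempty_iff_ne_empty]
    intro hem
    rw [hem] at hpos
    simp at hpos
  obtain ⟨q, hq⟩ := hne
  obtain ⟨hqT, hq0⟩ := Finset.mem_filter.1 hq
  simp only [hT, Finset.mem_product] at hqT
  exact ⟨_, hqT.1.1.1, _, hqT.1.1.2, _, hqT.1.2.1, _, hqT.1.2.2, _, hqT.2.1.1, _, hqT.2.1.2, _,
    hqT.2.2.1, _, hqT.2.2.2, hq0⟩

/-- If all values are close to zero, the Fourier coefficient is large. -/
lemma ft_large {R : Type u} (X : Finset R) (χ : R → TT) (h : ∀ x ∈ X, ‖χ x‖ ≤ 1 / 100) :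
    93 / 100 * (X.card : ℝ) ≤ ‖ft X χ‖ := by
  have h1 : ∑ x ∈ X, (ee (χ x)).re ≤ ‖ft X χ‖ := by
    rw [← Complex.re_sum]
    exact Complex.re_le_norm _
  have h2 : X.card • (93 / 100 : ℝ) ≤ ∑ x ∈ X, (ee (χ x)).re := by
    refine Finset.card_nsmul_le_sum _ _ _ fun x hx => ?_
    have := ee_re_ge (χ x)
    have := h x hx
    linarith
  rw [nsmul_eq_mul] at h2
  linarith

lemma ft_close {R : Type u} (X : Finset R) (χ γ : R → TT) {r : ℝ}
    (h : ∀ x ∈ X, ‖χ x - γ x‖ ≤ r) : ‖ft X χ‖ ≤ ‖ft X γ‖ + 7 * r * X.card := by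
  have e1 : ‖ft X χ - ft X γ‖ ≤ X.card * (7 * r) := by
    rw [ft, ft, ← Finset.sum_sub_distrib, ← nsmul_eq_mul]
    refine (norm_sum_le _ _).trans (Finset.sum_le_card_nsmul _ _ _ fun x hx => ?_)
    have : ee (χ x) - ee (γ x) = ee (γ x) * (ee (χ x - γ x) - 1) := by
      have : χ x = γ x + (χ x - γ x) := by abel
      conv_lhs => rw [this, ee_add]
      ring
    rw [this, norm_mul, norm_ee, one_mul]
    have e2 := norm_ee_sub_one_le (χ x - γ x)
    have e3 := h x hx
    linarith
  have e2 := norm_add_le (ft X γ) (ft X χ - ft X γ)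
  rw [add_sub_cancel] at e2
  linarith

lemma bog_term_bound {a b c n r α : ℝ} (ha0 : 0 ≤ a) (hb0 : 0 ≤ b) (hc0 : 0 ≤ c) (ha : a ≤ n)
    (hb : b ≤ n) (hc : c ≤ n) (hr : -1 ≤ r)
    (hcase : a ≤ 2 * α * n ∨ b ≤ 2 * α * n ∨ c ≤ 2 * α * n ∨ 0 ≤ r) :
    -(4 * α ^ 2 * n ^ 6 * a ^ 2) ≤ (a ^ 4 * b ^ 2 * c ^ 2) * r := by
  have hn0 : 0 ≤ n := ha0.trans ha
  have hw : 0 ≤ a ^ 4 * b ^ 2 * c ^ 2 := by positivity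
  have hbd : 0 ≤ 4 * α ^ 2 * n ^ 6 * a ^ 2 := by positivity
  have key : a ^ 4 * b ^ 2 * c ^ 2 ≤ 4 * α ^ 2 * n ^ 6 * a ^ 2 ∨ 0 ≤ r := by
    rcases hcase with h | h | h | h
    · left
      calc a ^ 4 * b ^ 2 * c ^ 2 = a ^ 2 * (a ^ 2 * b ^ 2 * c ^ 2) := by ring
        _ ≤ a ^ 2 * ((2 * α * n) ^ 2 * n ^ 2 * n ^ 2) := by gcongr
        _ = _ := by ring
    · left
      calc a ^ 4 * b ^ 2 * c ^ 2 = a ^ 2 * (a ^ 2 * b ^ 2 * c ^ 2) := by ring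
        _ ≤ a ^ 2 * (n ^ 2 * (2 * α * n) ^ 2 * n ^ 2) := by gcongr
        _ = _ := by ring
    · left
      calc a ^ 4 * b ^ 2 * c ^ 2 = a ^ 2 * (a ^ 2 * b ^ 2 * c ^ 2) := by ring
        _ ≤ a ^ 2 * (n ^ 2 * n ^ 2 * (2 * α * n) ^ 2) := by gcongr
        _ = _ := by ring
    · exact Or.inr h
  rcases key with h | h
  · nlinarith
  · have : 0 ≤ (a ^ 4 * b ^ 2 * c ^ 2) * r := mul_nonneg hw h
    linarith

lemma bog_pos {R : Type u} [AddCommGroup R] {G : AddSubgroup R} {P : Finset R}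
    {D : Finset (R → TT)} (h : IsDual G P D) {X Y : Finset R} (hX0 : 0 ∈ X) (hXY : X ⊆ Y)
    {f₁ f₂ : R → R} (h₁ : ∀ x ∈ X, f₁ x ∈ Y) (h₂ : ∀ x ∈ X, f₂ x ∈ Y) {w : R} (hw : w ∈ Y)
    {c M α : ℝ} (hα : 0 < α) (hM : (Y.card : ℝ) ≤ M * X.card)
    (hpar : ∑ χ ∈ D, ‖ft X χ‖ ^ 2 = (D.card : ℝ) * X.card)
    (hsm : c * D.card ≤ Y.card * (D.filter (fun χ => ∀ y ∈ Y, ‖χ y‖ ≤ 1 / 100)).card)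
    (hαc : 8 * α ^ 2 * M < c)
    (hcase : ∀ χ ∈ D, ‖ft X χ‖ ≤ 2 * α * X.card ∨
      ‖ft X (fun x => χ (f₁ x))‖ ≤ 2 * α * X.card ∨
      ‖ft X (fun x => χ (f₂ x))‖ ≤ 2 * α * X.card ∨ 0 ≤ (ee (χ w)).re) :
    0 < ∑ χ ∈ D, (‖ft X χ‖ ^ 4 * ‖ft X (fun x => χ (f₁ x))‖ ^ 2 *
      ‖ft X (fun x => χ (f₂ x))‖ ^ 2) * (ee (χ w)).re := by
  have hXpos : (0 : ℝ) < X.card := by exact_mod_cast Finset.card_pos.2 ⟨0, hX0⟩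
  have hDpos := h.card_pos
  set n : ℝ := (X.card : ℝ) with hn
  set N := D.filter (fun χ => ∀ y ∈ Y, ‖χ y‖ ≤ 1 / 100) with hN
  have hlow : ∀ χ ∈ D, (if χ ∈ N then n ^ 8 / 2 else 0) - 4 * α ^ 2 * n ^ 6 * ‖ft X χ‖ ^ 2 ≤
      (‖ft X χ‖ ^ 4 * ‖ft X (fun x => χ (f₁ x))‖ ^ 2 *
      ‖ft X (fun x => χ (f₂ x))‖ ^ 2) * (ee (χ w)).re := by
    intro χ hχ
    have ha := norm_ft_le X χ
    have hb := norm_ft_le X (fun x => χ (f₁ x))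
    have hc := norm_ft_le X (fun x => χ (f₂ x))
    rw [← hn] at ha hb hc
    have hre : -1 ≤ (ee (χ w)).re := by
      have := Complex.abs_re_le_norm (ee (χ w))
      rw [norm_ee] at this
      exact (abs_le.1 this).1
    split_ifs with hχN
    · have hχN' := (Finset.mem_filter.1 hχN).2
      have la := ft_large X χ (fun x hx => hχN' x (hXY hx))
      have lb := ft_large X (fun x => χ (f₁ x)) (fun x hx => hχN' _ (h₁ x hx))
      have lc := ft_large X (fun x => χ (f₂ x)) (fun x hx => hχN' _ (h₂ x hx))
      rw [← hn] at la lb lc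
      have lr := ee_re_ge (χ w)
      have lw := hχN' w hw
      have lr' : 93 / 100 ≤ (ee (χ w)).re := by linarith
      have hnn : 0 ≤ 4 * α ^ 2 * n ^ 6 * ‖ft X χ‖ ^ 2 := by positivity
      have : n ^ 8 / 2 ≤ ((93 / 100 * n) ^ 4 * (93 / 100 * n) ^ 2 * (93 / 100 * n) ^ 2) *
          (93 / 100) := by
        have : ((93 / 100 * n) ^ 4 * (93 / 100 * n) ^ 2 * (93 / 100 * n) ^ 2) *
          (93 / 100) = (93 / 100) ^ 9 * n ^ 8 := by ring
        rw [this]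
        have : (1 / 2 : ℝ) ≤ (93 / 100) ^ 9 := by norm_num
        have h8 : 0 ≤ n ^ 8 := by positivity
        nlinarith
      have h2 : ((93 / 100 * n) ^ 4 * (93 / 100 * n) ^ 2 * (93 / 100 * n) ^ 2) *
          (93 / 100) ≤ (‖ft X χ‖ ^ 4 * ‖ft X (fun x => χ (f₁ x))‖ ^ 2 *
          ‖ft X (fun x => χ (f₂ x))‖ ^ 2) * (ee (χ w)).re := by gcongr
      linarith
    · rw [zero_sub]
      exact bog_term_bound (norm_nonneg _) (norm_nonneg _) (norm_nonneg _) ha hb hc hre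
        (hcase χ hχ)
  refine lt_of_lt_of_le ?_ (Finset.sum_le_sum hlow)
  rw [Finset.sum_sub_distrib, ← Finset.mul_sum, hpar, ← Finset.sum_filter, Finset.sum_const,
    nsmul_eq_mul]
  have hND : D.filter (fun χ => χ ∈ N) = N := by
    ext χ
    simp only [Finset.mem_filter, hN]
    tauto
  rw [hND]
  have h1 : c * D.card ≤ M * n * N.card := hsm.trans (by gcongr)
  have hYpos : (0 : ℝ) < Y.card := by exact_mod_cast Finset.card_pos.2 ⟨w, hw⟩
  have hMpos : 0 < M := by
    by_contra hneg
    have : M * n ≤ 0 := mul_nonpos_of_nonpos_of_nonneg (not_lt.1 hneg) hXpos.le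
    linarith
  have h2 : M * (8 * α ^ 2 * D.card) < M * (n * N.card) := by
    have : 8 * α ^ 2 * M * D.card < c * D.card := by gcongr
    linarith
  have h3 := lt_of_mul_lt_mul_left h2 hMpos.le
  have h4 : (N.card : ℝ) * (n ^ 8 / 2) - 4 * α ^ 2 * n ^ 6 * (D.card * n) =
      n ^ 7 / 2 * (n * N.card - 8 * α ^ 2 * D.card) := by ring
  rw [h4]
  have h5 : 0 < n * N.card - 8 * α ^ 2 * D.card := by linarith
  positivity

end Bogolyubov

section BohrStructure

open scoped Classical

lemma sumN_add_subset {R : Type u} [AddCommGroup R] (A B : Finset R) (n : ℕ) :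
    sumN (A + B) n ⊆ sumN A n + sumN B n := by
  induction n with
  | zero => simp [sumN_zero]
  | succ n ih =>
    rw [sumN_succ, sumN_succ, sumN_succ]
    calc sumN (A + B) n + (A + B) ⊆ (sumN A n + sumN B n) + (A + B) :=
          Finset.add_subset_add_right ih
      _ = _ := by abel

variable {R : Type u} [NonUnitalRing R]

/-- Sums of `a` elements of `X` and `b` elements of `X * X`. -/
noncomputable def ZZ (X : Finset R) (a b : ℕ) : Finset R := sumN X a + sumN (X * X) b

lemma ZZ_add {X : Finset R} {a b a' b' : ℕ} {x y : R} (hx : x ∈ ZZ X a b) (hy : y ∈ ZZ X a' b') :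
    x + y ∈ ZZ X (a + a') (b + b') := by
  obtain ⟨p, hp, q, hq, rfl⟩ := Finset.mem_add.1 hx
  obtain ⟨p', hp', q', hq', rfl⟩ := Finset.mem_add.1 hy
  refine Finset.mem_add.2 ⟨p + p', add_mem_sumN hp hp', q + q', add_mem_sumN hq hq', by abel⟩

lemma zero_mem_mul {X : Finset R} (h0 : 0 ∈ X) : (0 : R) ∈ X * X :=
  Finset.mem_mul.2 ⟨0, h0, 0, h0, by simp⟩

lemma neg_mem_mul {X : Finset R} (hs : ∀ x ∈ X, -x ∈ X) : ∀ y ∈ X * X, -y ∈ X * X := by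
  intro y hy
  obtain ⟨a, ha, b, hb, rfl⟩ := Finset.mem_mul.1 hy
  exact Finset.mem_mul.2 ⟨-a, hs a ha, b, hb, by simp⟩

lemma ZZ_mono {X : Finset R} (h0 : 0 ∈ X) {a b a' b' : ℕ} (h : a ≤ a') (h' : b ≤ b') :
    ZZ X a b ⊆ ZZ X a' b' :=
  Finset.add_subset_add (sumN_mono h0 h) (sumN_mono (zero_mem_mul h0) h')

lemma zero_mem_ZZ {X : Finset R} (h0 : 0 ∈ X) (a b : ℕ) : (0 : R) ∈ ZZ X a b :=
  Finset.mem_add.2 ⟨0, zero_mem_sumN h0 a, 0, zero_mem_sumN (zero_mem_mul h0) b, by simp⟩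

lemma neg_mem_ZZ {X : Finset R} (hs : ∀ x ∈ X, -x ∈ X) {a b : ℕ} {x : R} (hx : x ∈ ZZ X a b) :
    -x ∈ ZZ X a b := by
  obtain ⟨p, hp, q, hq, rfl⟩ := Finset.mem_add.1 hx
  exact Finset.mem_add.2 ⟨-p, neg_mem_sumN hs hp, -q, neg_mem_sumN (neg_mem_mul hs) hq, by abel⟩

lemma sub_mem_ZZ {X : Finset R} (hs : ∀ x ∈ X, -x ∈ X) {a b a' b' : ℕ} {x y : R}
    (hx : x ∈ ZZ X a b) (hy : y ∈ ZZ X a' b') : x - y ∈ ZZ X (a + a') (b + b') := by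
  rw [sub_eq_add_neg]
  exact ZZ_add hx (neg_mem_ZZ hs hy)

lemma mem_ZZ_one {X : Finset R} {x : R} (hx : x ∈ X) : x ∈ ZZ X 1 0 := by
  rw [ZZ, sumN_one, sumN_zero]
  exact Finset.mem_add.2 ⟨x, hx, 0, by simp, by simp⟩

lemma mul_mem_ZZ_one {X : Finset R} {x y : R} (hx : x ∈ X) (hy : y ∈ X) : x * y ∈ ZZ X 0 1 := by
  rw [ZZ, sumN_one, sumN_zero]
  exact Finset.mem_add.2 ⟨0, by simp, x * y, Finset.mul_mem_mul hx hy, by simp⟩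

lemma ZZ_cover {X F : Finset R} (hadd : X + X ⊆ F + X) (hmul : X * X ⊆ F + X) (a b : ℕ) :
    ZZ X (a + 1) b ⊆ sumN F (a + 2 * b) + X := by
  calc ZZ X (a + 1) b ⊆ sumN X (a + 1) + (sumN F b + sumN X b) := by
        refine Finset.add_subset_add_left ?_
        exact (sumN_subset hmul b).trans (sumN_add_subset F X b)
    _ = sumN F b + sumN X (a + b + 1) := by
        have : a + b + 1 = (a + 1) + b := by omega
        rw [this, sumN_add X (a + 1) b]
        abel
    _ ⊆ sumN F b + (sumN F (a + b) + X) := Finset.add_subset_add_left (sumN_cover hadd _)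
    _ = sumN F (a + 2 * b) + X := by
        have : a + 2 * b = b + (a + b) := by omega
        rw [this, sumN_add F b (a + b), add_assoc]

/-- The ambient additive group. -/
def ambG (X : Finset R) : AddSubgroup R :=
  AddSubgroup.closure ((X ∪ X * X ∪ X * X * X : Finset R) : Set R)

lemma X_ambG {X : Finset R} {x : R} (hx : x ∈ X) : x ∈ ambG X :=
  AddSubgroup.subset_closure (by simp [hx])

lemma XX_ambG {X : Finset R} {x y : R} (hx : x ∈ X) (hy : y ∈ X) : x * y ∈ ambG X :=
  AddSubgroup.subset_closure (Finset.mem_coe.2 (Finset.mem_union_left _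
    (Finset.mem_union_right _ (Finset.mul_mem_mul hx hy))))

lemma XXX_ambG {X : Finset R} {x y z : R} (hx : x ∈ X) (hy : y ∈ X) (hz : z ∈ X) :
    x * y * z ∈ ambG X :=
  AddSubgroup.subset_closure (Finset.mem_coe.2 (Finset.mem_union_right _
    (Finset.mul_mem_mul (Finset.mul_mem_mul hx hy) hz)))

lemma ZZ_ambG {X : Finset R} {a b : ℕ} {x : R} (hx : x ∈ ZZ X a b) : x ∈ ambG X := by
  obtain ⟨p, hp, q, hq, rfl⟩ := Finset.mem_add.1 hx
  refine add_mem (sumN_subset_addSubgroup (fun x hx => X_ambG hx) a p hp)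
    (sumN_subset_addSubgroup (fun x hx => ?_) b q hq)
  obtain ⟨y, hy, z, hz, rfl⟩ := Finset.mem_mul.1 hx
  exact XX_ambG hy hz

lemma ZZ_cover_mem {X F FF : Finset R} (hadd : X + X ⊆ F + X) (hmul : X * X ⊆ F + X)
    {a a' b n : ℕ} (ha : a' = a + 1) (hn : n = a + 2 * b) (hF : FF = sumN F n) {x : R}
    (hx : x ∈ ZZ X a' b) : x ∈ FF + X := by
  subst ha hn hF
  exact ZZ_cover hadd hmul a b hx

lemma mem_ZZ {X : Finset R} {a b : ℕ} {x : R} :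
    x ∈ ZZ X a b ↔ ∃ p ∈ sumN X a, ∃ q ∈ sumN (X * X) b, p + q = x := Finset.mem_add

attribute [irreducible] ZZ

lemma closure_mul_ambG {X : Finset R} {g s : R} (hg : g ∈ AddSubgroup.closure (X : Set R))
    (hs : s ∈ X) : g * s ∈ ambG X := by
  induction hg using AddSubgroup.closure_induction with
  | mem x hx => exact XX_ambG hx hs
  | zero => rw [zero_mul]; exact zero_mem _
  | add a b _ _ iha ihb => rw [add_mul]; exact add_mem iha ihb
  | neg a _ iha => rw [neg_mul]; exact neg_mem iha

lemma mul_closure_ambG {X : Finset R} {g s : R} (hg : g ∈ AddSubgroup.closure (X : Set R))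
    (hs : s ∈ X) : s * g ∈ ambG X := by
  induction hg using AddSubgroup.closure_induction with
  | mem x hx => exact XX_ambG hs hx
  | zero => rw [mul_zero]; exact zero_mem _
  | add a b _ _ iha ihb => rw [mul_add]; exact add_mem iha ihb
  | neg a _ iha => rw [mul_neg]; exact neg_mem iha

/-- Choice of an element avoiding all small exceptional sets. -/
lemma exists_avoid {R : Type u} {A : Type*} (X : Finset R) (h0 : X.Nonempty) (Γ : Finset A) (d : ℕ)
    (hΓ : Γ.card ≤ d) (N₁ N₂ : A → Finset R) :
    ∃ s ∈ X, ∀ γ ∈ Γ,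
      (((N₁ γ).card : ℝ) ≤ 1 / (4 * (d + 1)) * X.card → s ∉ N₁ γ) ∧
      (((N₂ γ).card : ℝ) ≤ 1 / (4 * (d + 1)) * X.card → s ∉ N₂ γ) := by
  by_contra! hcon
  have hXpos : (0 : ℝ) < X.card := by exact_mod_cast h0.card_pos
  set τ : ℝ := 1 / (4 * (d + 1)) with hτ
  have hτ0 : 0 < τ := by positivity
  let f : Finset R → Finset R := fun N => if (N.card : ℝ) ≤ τ * X.card then N else ∅
  have hf : ∀ N, ((f N).card : ℝ) ≤ τ * X.card := by
    intro N
    simp only [f]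
    split_ifs with h
    · exact h
    · simp; positivity
  have hsub : X ⊆ Γ.biUnion (fun γ => f (N₁ γ) ∪ f (N₂ γ)) := by
    intro s hs
    obtain ⟨γ, hγ, hγ'⟩ := hcon s hs
    refine Finset.mem_biUnion.2 ⟨γ, hγ, ?_⟩
    by_cases h1 : ((N₁ γ).card : ℝ) ≤ τ * X.card ∧ s ∈ N₁ γ
    · refine Finset.mem_union_left _ ?_
      simp only [f, h1.1, if_true]
      exact h1.2
    · obtain ⟨h2, h3⟩ := hγ' (fun h hs => h1 ⟨h, hs⟩)
      refine Finset.mem_union_right _ ?_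
      simp only [f, h2, if_true]
      exact h3
  have h1 : (X.card : ℝ) ≤ ∑ γ ∈ Γ, ((f (N₁ γ) ∪ f (N₂ γ)).card : ℝ) := by
    exact_mod_cast (Finset.card_le_card hsub).trans Finset.card_biUnion_le
  have h2 : ∑ γ ∈ Γ, ((f (N₁ γ) ∪ f (N₂ γ)).card : ℝ) ≤ Γ.card • (2 * (τ * X.card)) := by
    refine Finset.sum_le_card_nsmul _ _ _ fun γ _ => ?_
    have e1 : ((f (N₁ γ) ∪ f (N₂ γ)).card : ℝ) ≤ (f (N₁ γ)).card + (f (N₂ γ)).card := by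
      exact_mod_cast Finset.card_union_le _ _
    have := hf (N₁ γ)
    have := hf (N₂ γ)
    linarith
  rw [nsmul_eq_mul] at h2
  have h3 : (Γ.card : ℝ) ≤ d := by exact_mod_cast hΓ
  have h4 : (Γ.card : ℝ) * (2 * (τ * X.card)) ≤ (d + 1) * (2 * (τ * X.card)) := by
    gcongr
    linarith
  have h5 : ((d : ℝ) + 1) * (2 * (τ * X.card)) = X.card / 2 := by
    rw [hτ]
    field_simp
    norm_num
  linarith

lemma bohr_structure (K : ℕ) : ∃ d m : ℕ, ∀ (R : Type u) [NonUnitalRing R] (X F : Finset R),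
    0 ∈ X → (∀ x ∈ X, -x ∈ X) → X + X ⊆ F + X → X * X ⊆ F + X → F.card ≤ K →
    ∃ Γ : Finset (R → TT), Γ.card ≤ d ∧
      (∀ γ ∈ Γ, ∀ x ∈ ambG X, ∀ y ∈ ambG X, γ (x + y) = γ x + γ y) ∧
      (∀ w ∈ ZZ X 32 32, (∀ γ ∈ Γ, ‖γ w‖ ≤ 1 / 8) → w ∈ ZZ X 4 4) ∧
      ∀ γ ∈ Γ, (∃ col : R → Fin (m + 1), ∀ s ∈ X, ∀ s' ∈ X, col s = col s' →
          ∀ x ∈ X, ‖γ (x * s) - γ (x * s')‖ ≤ 1 / 1000) ∧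
        (∃ col : R → Fin (m + 1), ∀ s ∈ X, ∀ s' ∈ X, col s = col s' →
          ∀ x ∈ X, ‖γ (s * x) - γ (s' * x)‖ ≤ 1 / 1000) := by
  obtain ⟨L, hL⟩ : ∃ L : ℕ, L = (191 + 1) ^ K := ⟨_, rfl⟩
  have hL0 : 1 ≤ L := by rw [hL]; exact Nat.one_le_pow _ _ (Nat.succ_pos _)
  have hL1 : (1 : ℝ) ≤ L := Nat.one_le_cast.2 hL0
  obtain ⟨c1, hc1, m1, hm1⟩ := many_small_characters.{u} L (1 / 100) (by norm_num)
  set α : ℝ := min 1 (c1 / (9 * L)) with hα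
  have hα0 : 0 < α := by rw [hα]; positivity
  have hα1 : α ≤ 1 := min_le_left _ _
  have hαc : 8 * α ^ 2 * L < c1 := by
    have h1 : α ≤ c1 / (9 * L) := min_le_right _ _
    rw [le_div_iff₀ (by positivity)] at h1
    have h2 : α ^ 2 ≤ α := by nlinarith
    have h3 : α ^ 2 * L ≤ α * L := by gcongr
    nlinarith
  set ε : ℝ := min (α / 14) (1 / 10000) with hε
  have hε0 : 0 < ε := by rw [hε]; positivity
  have hεα : 14 * ε ≤ α := by
    have : ε ≤ α / 14 := min_le_left _ _
    linarith
  have hε1 : ε ≤ 1 / 10000 := min_le_right _ _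
  obtain ⟨c2, hc2, m2, hm2⟩ := many_small_characters.{u} L ε hε0
  set d : ℕ := ⌈4 * (L : ℝ) / (α ^ 2 * c2)⌉₊ with hd
  set τ : ℝ := 1 / (4 * (d + 1)) with hτ
  have hτ0 : 0 < τ := by positivity
  obtain ⟨m, hm⟩ := dichotomy.{u} K α ε τ hα0 hε0 hεα hτ0
  refine ⟨d, m, ?_⟩
  intro R _ X F h0 hsym hadd hmul hFK
  have hXpos : (0 : ℝ) < X.card := by exact_mod_cast Finset.card_pos.2 ⟨0, h0⟩
  have hY0 : (0 : R) ∈ ZZ X 32 32 := zero_mem_ZZ h0 32 32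
  have hYsym : ∀ y ∈ ZZ X 32 32, -y ∈ ZZ X 32 32 := fun y hy => neg_mem_ZZ hsym hy
  have hYG : ∀ y ∈ ZZ X 32 32, y ∈ ambG X := fun y hy => ZZ_ambG hy
  set Y := ZZ X 32 32 with hY
  have hXY : X ⊆ Y := fun x hx => ZZ_mono h0 (by norm_num) (by norm_num) (mem_ZZ_one hx)
  have hXXY : ∀ x ∈ X, ∀ y ∈ X, x * y ∈ Y := fun x hx y hy =>
    ZZ_mono h0 (by norm_num) (by norm_num) (mul_mem_ZZ_one hx hy)
  obtain ⟨FF, hFF⟩ : ∃ FF, FF = sumN F 191 := ⟨_, rfl⟩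
  have hFY : FF.card ≤ L := by
    rw [hL, hFF]
    exact (card_sumN_le F 191).trans (Nat.pow_le_pow_right (Nat.succ_pos _) hFK)
  have hYY : Y + Y ⊆ FF + Y := by
    intro x hx
    obtain ⟨a, ha, b, hb, rfl⟩ := Finset.mem_add.1 hx
    have := ZZ_cover_mem hadd hmul (a := 63) (by norm_num) (by norm_num) hFF (ZZ_add ha hb)
    exact Finset.add_subset_add_left hXY this
  have hYM : (Y.card : ℝ) ≤ L * X.card := by
    have h1 : Y.card ≤ L * X.card := by
      rw [hL]
      refine (Finset.card_le_card (ZZ_cover hadd hmul 31 32)).trans (Finset.card_add_le.trans ?_)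
      refine Nat.mul_le_mul_right _ ((card_sumN_le F _).trans ?_)
      exact (Nat.pow_le_pow_left (by norm_num) _).trans (Nat.pow_le_pow_right (by norm_num) hFK)
    exact_mod_cast h1
  have h44 : ZZ X 4 4 ⊆ Y := ZZ_mono h0 (by norm_num) (by norm_num)
  clear_value Y
  obtain ⟨D, hD, -⟩ := exists_dual (X ∪ X * X ∪ X * X * X) (sumN Y (m1 + m2 + 2))
    (sumN_subset_addSubgroup hYG _) ∅ (by simp) (by simp)
  change IsDual (ambG X) _ D at hD
  have hsm1 := hm1 R (ambG X) _ D Y _ hD hY0 hYsym hYG hYY hFY (sumN_mono hY0 (by omega))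
  have hsm2 := hm2 R (ambG X) _ D Y _ hD hY0 hYsym hYG hYY hFY (sumN_mono hY0 (by omega))
  have hP2 : ∀ y ∈ Y, ∀ z ∈ Y, y + z ∈ sumN Y (m1 + m2 + 2) := by
    intro y hy z hz
    refine sumN_mono hY0 (show 2 ≤ m1 + m2 + 2 by omega) ?_
    rw [sumN_two]
    exact Finset.add_mem_add hy hz
  have hpar := hD.parseval (A := X) (fun x hx => X_ambG hx) (fun x hx y hy => by
    rw [sub_eq_add_neg]
    exact hP2 x (hXY hx) _ (hXY (hsym y hy)))
  obtain ⟨Γ, hΓD, hΓc, hΓ⟩ := spec_cover hD h0 hXY hα0 hεα hc2 hYM hpar hsm2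
  have hΓd : Γ.card ≤ d := by
    have := hΓc.trans (Nat.le_ceil _)
    rw [hd]
    exact Nat.cast_le.1 this
  clear_value d
  let NL : (R → TT) → Finset R := fun γ =>
    X.filter (fun s => α * X.card ≤ ‖ft X (fun x => γ (x * s))‖)
  let NR : (R → TT) → Finset R := fun γ =>
    X.filter (fun s => α * X.card ≤ ‖ft X (fun x => γ (s * x))‖)
  obtain ⟨s, hs, havoid⟩ := exists_avoid X ⟨0, h0⟩ Γ d hΓd NL NR
  let Γg := Γ.filter (fun γ => ¬ ((NL γ).card : ℝ) ≤ τ * X.card ∧ ¬ ((NR γ).card : ℝ) ≤ τ * X.card)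
  refine ⟨Γg, (Finset.card_le_card (Finset.filter_subset _ _)).trans hΓd, ?_, ?_, ?_⟩
  · intro γ hγ
    exact hD.hadd γ (hΓD (Finset.mem_filter.1 hγ).1)
  · intro w hw hwγ
    have hpos := bog_pos hD h0 hXY (f₁ := fun x => x * s) (f₂ := fun x => s * x)
      (fun x hx => hXXY x hx s hs) (fun x hx => hXXY s hs x hx) hw hα0 hYM hpar hsm1 hαc (by
        intro χ hχ
        by_cases h1 : α * X.card ≤ ‖ft X χ‖
        · obtain ⟨γ, hγ, hclose⟩ := hΓ χ hχ h1
          by_cases hL' : ((NL γ).card : ℝ) ≤ τ * X.card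
          · right; left
            have h2 := (havoid γ hγ).1 hL'
            have h3 : ‖ft X (fun x => γ (x * s))‖ < α * X.card := by
              by_contra hcon
              exact h2 (Finset.mem_filter.2 ⟨hs, not_lt.1 hcon⟩)
            have h4 := ft_close X (fun x => χ (x * s)) (fun x => γ (x * s))
              (fun x hx => hclose _ (hXXY x hx s hs))
            nlinarith
          · by_cases hR' : ((NR γ).card : ℝ) ≤ τ * X.card
            · right; right; left
              have h2 := (havoid γ hγ).2 hR'
              have h3 : ‖ft X (fun x => γ (s * x))‖ < α * X.card := by
                by_contra hcon
                exact h2 (Finset.mem_filter.2 ⟨hs, not_lt.1 hcon⟩)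
              have h4 := ft_close X (fun x => χ (s * x)) (fun x => γ (s * x))
                (fun x hx => hclose _ (hXXY s hs x hx))
              nlinarith
            · right; right; right
              have h2 := hwγ γ (Finset.mem_filter.2 ⟨hγ, hL', hR'⟩)
              have h3 := hclose w hw
              apply ee_re_nonneg
              have h4 := norm_add_le (χ w - γ w) (γ w)
              rw [sub_add_cancel] at h4
              linarith
        · left
          push Not at h1
          nlinarith)
    have h4 : ∀ a ∈ X, ∀ a' ∈ X, ∀ b ∈ X, ∀ b' ∈ X, ∀ c ∈ X, ∀ c' ∈ X, ∀ e ∈ X, ∀ e' ∈ X,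
        ((a - a') + (b - b')) + ((c * s - c' * s) + (s * e - s * e')) ∈ ZZ X 4 4 := by
      intro a ha a' ha' b hb b' hb' c hc c' hc' e he e' he'
      have e1 := ZZ_add (sub_mem_ZZ hsym (mem_ZZ_one ha) (mem_ZZ_one ha'))
        (sub_mem_ZZ hsym (mem_ZZ_one hb) (mem_ZZ_one hb'))
      have e2 := ZZ_add (sub_mem_ZZ hsym (mul_mem_ZZ_one hc hs) (mul_mem_ZZ_one hc' hs))
        (sub_mem_ZZ hsym (mul_mem_ZZ_one hs he) (mul_mem_ZZ_one hs he'))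
      exact ZZ_add e1 e2
    obtain ⟨a, ha, a', ha', b, hb, b', hb', c, hc, c', hc', e, he, e', he', heq⟩ :=
      bog_support hD (fun x hx => X_ambG hx) (f₁ := fun x => x * s) (f₂ := fun x => s * x)
      (fun x hx => XX_ambG hx hs) (fun x hx => XX_ambG hs hx) (hYG w hw)
      (fun a ha a' ha' b hb b' hb' c hc c' hc' e he e' he' =>
        hP2 _ (h44
          (h4 a ha a' ha' b hb b' hb' c hc c' hc' e he e' he')) _ hw) hpos
    have h5 := neg_mem_ZZ hsym (h4 a ha a' ha' b hb b' hb' c hc c' hc' e he e' he')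
    rwa [neg_eq_of_add_eq_zero_right heq] at h5
  · intro γ hγ
    obtain ⟨hγΓ, hγL, hγR⟩ := Finset.mem_filter.1 hγ
    have hγD := hΓD hγΓ
    obtain ⟨N, hN0, hN⟩ := hD.tors γ hγD
    have hXc : ∀ x ∈ X, x ∈ AddSubgroup.closure (X : Set R) :=
      fun x hx => AddSubgroup.subset_closure hx
    constructor
    · rcases hm R X F (fun s x => γ (x * s)) h0 hsym hadd hFK
        (fun s hs x hx y hy => by
          rw [add_mul]
          exact hD.hadd γ hγD _ (closure_mul_ambG hx hs) _ (closure_mul_ambG hy hs))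
        (fun x hx s hs t ht => by
          rw [mul_add]
          exact hD.hadd γ hγD _ (mul_closure_ambG hs hx) _ (mul_closure_ambG ht hx))
        (fun s hs => ⟨N, hN0, by
          funext x
          exact congrFun hN (x * s)⟩) with h1 | ⟨col, hcol⟩
      · exact absurd h1 hγL
      · refine ⟨col, fun s hs s' hs' hc x hx => (hcol s hs s' hs' hc x hx).trans ?_⟩
        linarith
    · rcases hm R X F (fun s x => γ (s * x)) h0 hsym hadd hFK
        (fun s hs x hx y hy => by
          rw [mul_add]
          exact hD.hadd γ hγD _ (mul_closure_ambG hx hs) _ (mul_closure_ambG hy hs))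
        (fun x hx s hs t ht => by
          rw [add_mul]
          exact hD.hadd γ hγD _ (closure_mul_ambG hs hx) _ (closure_mul_ambG ht hx))
        (fun s hs => ⟨N, hN0, by
          funext x
          exact congrFun hN (s * x)⟩) with h1 | ⟨col, hcol⟩
      · exact absurd h1 hγR
      · refine ⟨col, fun s hs s' hs' hc x hx => (hcol s hs s' hs' hc x hx).trans ?_⟩
        linarith

end BohrStructure


section Assembly

open scoped Classical

/-- The relation `P` on `X` contains the relation of having the same colour,
for some colouring with `n` colours. -/
def NC {R : Type u} (X : Finset R) (n : ℕ) (P : R → R → Prop) : Prop :=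
  ∃ c : R → Fin n, ∀ s ∈ X, ∀ s' ∈ X, c s = c s' → P s s'

lemma NC.mono {R : Type u} {X : Finset R} {n m : ℕ} {P Q : R → R → Prop} (h : NC X n P)
    (hnm : n ≤ m) (hPQ : ∀ s ∈ X, ∀ s' ∈ X, P s s' → Q s s') : NC X m Q := by
  obtain ⟨c, hc⟩ := h
  refine ⟨fun s => Fin.castLE hnm (c s), fun s hs s' hs' h => hPQ s hs s' hs' (hc s hs s' hs' ?_)⟩
  exact Fin.castLE_injective hnm h

lemma NC.and {R : Type u} {X : Finset R} {n m : ℕ} {P Q : R → R → Prop} (h : NC X n P)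
    (h' : NC X m Q) : NC X (n * m) (fun s s' => P s s' ∧ Q s s') := by
  obtain ⟨c, hc⟩ := h
  obtain ⟨c', hc'⟩ := h'
  refine ⟨fun s => finProdFinEquiv (c s, c' s), fun s hs s' hs' h => ?_⟩
  have h1 := finProdFinEquiv.injective h
  rw [Prod.mk.injEq] at h1
  exact ⟨hc s hs s' hs' h1.1, hc' s hs s' hs' h1.2⟩

lemma NC.all_aux {R : Type u} {A : Type*} {X : Finset R} {n : ℕ} {P : A → R → R → Prop}
    (T : Finset A) (h : ∀ i ∈ T, NC X n (P i)) :
    NC X (n ^ T.card) (fun s s' => ∀ i ∈ T, P i s s') := by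
  induction T using Finset.induction_on with
  | empty => exact ⟨fun _ => ⟨0, by simp⟩, by simp⟩
  | insert a T ha ih =>
    have h1 := (ih fun i hi => h i (Finset.mem_insert_of_mem hi)).and
      (h a (Finset.mem_insert_self a T))
    rw [Finset.card_insert_of_notMem ha, pow_succ]
    refine h1.mono le_rfl ?_
    intro s _ s' _ h2 i hi
    rcases Finset.mem_insert.1 hi with rfl | hi
    · exact h2.2
    · exact h2.1 i hi

lemma NC.all {R : Type u} {A : Type*} {X : Finset R} {n k : ℕ} {P : A → R → R → Prop}
    (T : Finset A) (hn : 0 < n) (hk : T.card ≤ k) (h : ∀ i ∈ T, NC X n (P i)) :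
    NC X (n ^ k) (fun s s' => ∀ i ∈ T, P i s s') :=
  (NC.all_aux T h).mono (Nat.pow_le_pow_right hn hk) (fun _ _ _ _ h => h)

lemma NC.cover {R : Type u} [AddCommGroup R] {X : Finset R} {n : ℕ} {P : R → R → Prop}
    (h : NC X n P) : ∃ E : Finset R, E.card ≤ n ∧
      ∀ s ∈ X, ∃ e ∈ E, e ∈ X ∧ P s e := by
  obtain ⟨c, hc⟩ := h
  let f : Fin n → R := fun i => if h : ∃ s ∈ X, c s = i then h.choose else 0
  refine ⟨Finset.univ.image f, Finset.card_image_le.trans (by simp), fun s hs => ?_⟩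
  have hex : ∃ t ∈ X, c t = c s := ⟨s, hs, rfl⟩
  have hf : f (c s) = hex.choose := by simp only [f, hex, dif_pos]
  refine ⟨f (c s), Finset.mem_image_of_mem _ (Finset.mem_univ _), ?_, ?_⟩
  · rw [hf]; exact hex.choose_spec.1
  · rw [hf]; exact hc s hs _ hex.choose_spec.1 hex.choose_spec.2.symm

lemma NC.shift {R : Type u} [AddCommGroup R] {X F : Finset R} {K : ℕ} (hF : F.card ≤ K)
    (f : R → R) (hf : ∀ s ∈ X, f s ∈ F + X) :
    NC X (K + 1) (fun s s' => ∃ x ∈ X, ∃ x' ∈ X, f s - f s' = x - x') := by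
  obtain ⟨g, hg⟩ := exists_color F K hF
  have hex : ∀ s, ∃ p, s ∈ X → p ∈ F ∧ ∃ x ∈ X, p + x = f s := by
    intro s
    by_cases hs : s ∈ X
    · obtain ⟨p, hp, x, hx, h⟩ := Finset.mem_add.1 (hf s hs)
      exact ⟨p, fun _ => ⟨hp, x, hx, h⟩⟩
    · exact ⟨0, fun h => absurd h hs⟩
  choose p hp using hex
  refine ⟨fun s => g (p s), fun s hs s' hs' h => ?_⟩
  obtain ⟨h1, x, hx, e⟩ := hp s hs
  obtain ⟨h1', x', hx', e'⟩ := hp s' hs'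
  have := hg h1 h1' h
  refine ⟨x, hx, x', hx', ?_⟩
  rw [← e, ← e', this]
  abel

lemma NC.circle {R : Type u} {X : Finset R} {N : ℕ} {r : ℝ} {c : TT → Fin N}
    (hc : ∀ a b, c a = c b → ‖a - b‖ ≤ r) (f : R → TT) :
    NC X N (fun s s' => ‖f s - f s'‖ ≤ r) :=
  ⟨fun s => c (f s), fun _ _ _ _ h => hc _ _ h⟩

variable {R : Type u} [NonUnitalRing R]

/-- A small element of `ZZ X 0 k`. -/
def Pr (X : Finset R) (Γ : Finset (R → TT)) (k : ℕ) (δ : ℝ) (u : R) : Prop :=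
  u ∈ ZZ X 0 k ∧ ∀ γ ∈ Γ, ‖γ u‖ ≤ δ

lemma Pr.add {X : Finset R} {Γ : Finset (R → TT)}
    (hΓ : ∀ γ ∈ Γ, ∀ x ∈ ambG X, ∀ y ∈ ambG X, γ (x + y) = γ x + γ y)
    {k k' : ℕ} {δ δ' : ℝ} {u u' : R} (h : Pr X Γ k δ u) (h' : Pr X Γ k' δ' u') :
    Pr X Γ (k + k') (δ + δ') (u + u') := by
  refine ⟨ZZ_add h.1 h'.1, fun γ hγ => ?_⟩
  rw [hΓ γ hγ u (ZZ_ambG h.1) u' (ZZ_ambG h'.1)]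
  exact (norm_add_le _ _).trans (add_le_add (h.2 γ hγ) (h'.2 γ hγ))

lemma Pr.sumN {X : Finset R} {Γ : Finset (R → TT)} (h0 : 0 ∈ X)
    (hΓ : ∀ γ ∈ Γ, ∀ x ∈ ambG X, ∀ y ∈ ambG X, γ (x + y) = γ x + γ y)
    {k : ℕ} {δ : ℝ} (A : Finset R) (h : R →+ R) (hA : ∀ a ∈ A, Pr X Γ k δ (h a)) (n : ℕ) :
    ∀ w ∈ sumN A n, Pr X Γ (n * k) (n * δ) (h w) := by
  induction n with
  | zero =>
    intro w hw
    rw [sumN_zero, Finset.mem_singleton] at hw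
    subst hw
    refine ⟨by rw [map_zero]; exact zero_mem_ZZ h0 _ _, fun γ hγ => ?_⟩
    have := hΓ γ hγ 0 (zero_mem _) 0 (zero_mem _)
    have h2 : γ 0 = 0 := by simpa using this
    simp [h2]
  | succ n ih =>
    intro w hw
    rw [sumN_succ] at hw
    obtain ⟨a, ha, b, hb, rfl⟩ := Finset.mem_add.1 hw
    have := (ih a ha).add hΓ (hA b hb)
    rw [map_add, add_mul, one_mul]
    push_cast
    rw [add_mul, one_mul]
    exact this

lemma Pr.ZZ {X : Finset R} {Γ : Finset (R → TT)} (h0 : 0 ∈ X)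
    (hΓ : ∀ γ ∈ Γ, ∀ x ∈ ambG X, ∀ y ∈ ambG X, γ (x + y) = γ x + γ y)
    (h : R →+ R) (hX : ∀ a ∈ X, Pr X Γ 2 (1 / 1000) (h a))
    (hXX : ∀ a ∈ X, ∀ b ∈ X, Pr X Γ 6 (1 / 300 + 1 / 1000) (h (a * b))) {w : R}
    (hw : w ∈ ZZ X 4 4) : Pr X Γ 32 (1 / 32) (h w) := by
  obtain ⟨p, hp, q, hq, rfl⟩ := mem_ZZ.1 hw
  have h1 := Pr.sumN h0 hΓ X h hX 4 p hp
  have h2 := Pr.sumN h0 hΓ (X * X) h (fun v hv => by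
    obtain ⟨a, ha, b, hb, rfl⟩ := Finset.mem_mul.1 hv
    exact hXX a ha b hb) 4 q hq
  have h3 := h1.add hΓ h2
  rw [map_add]
  refine ⟨ZZ_mono h0 le_rfl (by norm_num) h3.1, fun γ hγ => (h3.2 γ hγ).trans ?_⟩
  norm_num

lemma iterX_zero_mem {X : Set R} (h0 : (0 : R) ∈ X) (n : ℕ) : (0 : R) ∈ iterX X n := by
  induction n with
  | zero => exact h0
  | succ n ih =>
    have := Set.add_mem_add (Set.add_mem_add ih ih) (Set.mul_mem_mul ih ih)
    simpa [iterX] using this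

lemma iterX_add {X : Set R} (h0 : (0 : R) ∈ X) {n : ℕ} {a b : R} (ha : a ∈ iterX X n)
    (hb : b ∈ iterX X n) : a + b ∈ iterX X (n + 1) := by
  have h := iterX_zero_mem h0 n
  have := Set.add_mem_add (Set.add_mem_add ha hb) (Set.mul_mem_mul h h)
  rw [mul_zero, add_zero] at this
  exact this

lemma iterX_one {X : Set R} (h0 : (0 : R) ∈ X) {a b c : R} (ha : a ∈ X) (hb : b ∈ X) (hc : c ∈ X) :
    a + b * c ∈ iterX X 1 := by
  have := Set.add_mem_add (Set.add_mem_add ha h0) (Set.mul_mem_mul hb hc)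
  rw [add_zero] at this
  exact this

lemma mem_sumN_four {A : Finset R} {p : R} (hp : p ∈ sumN A 4) :
    ∃ a ∈ A, ∃ b ∈ A, ∃ c ∈ A, ∃ e ∈ A, p = a + b + (c + e) := by
  rw [show 4 = 2 + 2 from rfl, sumN_add, sumN_two] at hp
  obtain ⟨u, hu, v, hv, rfl⟩ := Finset.mem_add.1 hp
  obtain ⟨a, ha, b, hb, rfl⟩ := Finset.mem_add.1 hu
  obtain ⟨c, hc, e, he, rfl⟩ := Finset.mem_add.1 hv
  exact ⟨a, ha, b, hb, c, hc, e, he, rfl⟩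

lemma ZZ_iterX {X : Finset R} (h0 : 0 ∈ X) {w : R} (hw : w ∈ ZZ X 4 4) :
    w ∈ iterX (X : Set R) 3 := by
  obtain ⟨p, hp, q, hq, rfl⟩ := mem_ZZ.1 hw
  obtain ⟨a, ha, b, hb, c, hc, e, he, rfl⟩ := mem_sumN_four hp
  obtain ⟨a', ha', b', hb', c', hc', e', he', rfl⟩ := mem_sumN_four hq
  have key : ∀ x ∈ X, ∀ v ∈ X * X, x + v ∈ iterX (X : Set R) 1 := by
    intro x hx v hv
    obtain ⟨y, hy, z, hz, rfl⟩ := Finset.mem_mul.1 hv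
    exact iterX_one (Finset.mem_coe.2 h0) hx hy hz
  have h0' : (0 : R) ∈ (X : Set R) := Finset.mem_coe.2 h0
  have := iterX_add h0' (iterX_add h0' (key a ha a' ha') (key b hb b' hb'))
    (iterX_add h0' (key c hc c' hc') (key e he e' he'))
  convert this using 1
  abel

/-- Conditions on a pair of elements for the difference to act well. -/
def Good (X T : Finset R) (Γ : Finset (R → TT)) (s s' : R) : Prop :=
  (∀ γ ∈ Γ, (((∀ x ∈ X, ‖γ (x * s) - γ (x * s')‖ ≤ 1 / 1000) ∧
      (∀ x ∈ X, ‖γ (s * x) - γ (s' * x)‖ ≤ 1 / 1000)) ∧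
      ‖γ s - γ s'‖ ≤ 1 / 8) ∧
      ∀ f ∈ T, ‖γ (f * s) - γ (f * s')‖ ≤ 1 / 300 ∧ ‖γ (s * f) - γ (s' * f)‖ ≤ 1 / 300) ∧
    ∀ f ∈ T, f * (s - s') ∈ ZZ X 0 4 ∧ (s - s') * f ∈ ZZ X 0 4

lemma gamma_sub {X : Finset R} {γ : R → TT}
    (hγ : ∀ x ∈ ambG X, ∀ y ∈ ambG X, γ (x + y) = γ x + γ y) {x y : R} (hx : x ∈ ambG X)
    (hy : y ∈ ambG X) : γ (x - y) = γ x - γ y := by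
  have := hγ (x - y) (sub_mem hx hy) y hy
  rw [sub_add_cancel] at this
  rw [this, add_sub_cancel_right]

lemma Good.left {X F T : Finset R} {Γ : Finset (R → TT)} (h0 : 0 ∈ X) (hsym : ∀ x ∈ X, -x ∈ X)
    (hmul : X * X ⊆ F + X)
    (hT : ∀ f, f ∈ T ↔ f ∈ F ∧ ∃ y ∈ X, ∃ z ∈ X, ∃ x ∈ X, f + x = y * z)
    (hΓ : ∀ γ ∈ Γ, ∀ x ∈ ambG X, ∀ y ∈ ambG X, γ (x + y) = γ x + γ y) {s s' : R}
    (hs : s ∈ X) (hs' : s' ∈ X) (hg : Good X T Γ s s') {w : R} (hw : w ∈ ZZ X 4 4) :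
    Pr X Γ 32 (1 / 32) (w * (s - s')) := by
  have hX : ∀ a ∈ X, Pr X Γ 2 (1 / 1000) (a * (s - s')) := by
    intro a ha
    rw [mul_sub]
    refine ⟨sub_mem_ZZ hsym (mul_mem_ZZ_one ha hs) (mul_mem_ZZ_one ha hs'), fun γ hγ => ?_⟩
    rw [gamma_sub (hΓ γ hγ) (XX_ambG ha hs) (XX_ambG ha hs')]
    exact (hg.1 γ hγ).1.1.1 a ha
  refine Pr.ZZ h0 hΓ (AddMonoidHom.mulRight (s - s')) hX ?_ hw
  intro a ha b hb
  change Pr X Γ 6 (1 / 300 + 1 / 1000) (a * b * (s - s'))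
  obtain ⟨f, hf, x, hx, e⟩ := Finset.mem_add.1 (hmul (Finset.mul_mem_mul ha hb))
  have hfT : f ∈ T := (hT f).2 ⟨hf, a, ha, b, hb, x, hx, e⟩
  have hfe : f = a * b - x := eq_sub_of_add_eq e
  have hfG : ∀ u ∈ X, f * u ∈ ambG X := by
    intro u hu
    rw [hfe, sub_mul]
    exact sub_mem (XXX_ambG ha hb hu) (XX_ambG hx hu)
  rw [← e, add_mul]
  refine Pr.add hΓ (k := 4) (k' := 2) ⟨(hg.2 f hfT).1, fun γ hγ => ?_⟩ (hX x hx)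
  rw [mul_sub, gamma_sub (hΓ γ hγ) (hfG s hs) (hfG s' hs')]
  exact ((hg.1 γ hγ).2 f hfT).1

lemma Good.right {X F T : Finset R} {Γ : Finset (R → TT)} (h0 : 0 ∈ X) (hsym : ∀ x ∈ X, -x ∈ X)
    (hmul : X * X ⊆ F + X)
    (hT : ∀ f, f ∈ T ↔ f ∈ F ∧ ∃ y ∈ X, ∃ z ∈ X, ∃ x ∈ X, f + x = y * z)
    (hΓ : ∀ γ ∈ Γ, ∀ x ∈ ambG X, ∀ y ∈ ambG X, γ (x + y) = γ x + γ y) {s s' : R}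
    (hs : s ∈ X) (hs' : s' ∈ X) (hg : Good X T Γ s s') {w : R} (hw : w ∈ ZZ X 4 4) :
    Pr X Γ 32 (1 / 32) ((s - s') * w) := by
  have hX : ∀ a ∈ X, Pr X Γ 2 (1 / 1000) ((s - s') * a) := by
    intro a ha
    rw [sub_mul]
    refine ⟨sub_mem_ZZ hsym (mul_mem_ZZ_one hs ha) (mul_mem_ZZ_one hs' ha), fun γ hγ => ?_⟩
    rw [gamma_sub (hΓ γ hγ) (XX_ambG hs ha) (XX_ambG hs' ha)]
    exact (hg.1 γ hγ).1.1.2 a ha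
  refine Pr.ZZ h0 hΓ (AddMonoidHom.mulLeft (s - s')) hX ?_ hw
  intro a ha b hb
  change Pr X Γ 6 (1 / 300 + 1 / 1000) ((s - s') * (a * b))
  obtain ⟨f, hf, x, hx, e⟩ := Finset.mem_add.1 (hmul (Finset.mul_mem_mul ha hb))
  have hfT : f ∈ T := (hT f).2 ⟨hf, a, ha, b, hb, x, hx, e⟩
  have hfe : f = a * b - x := eq_sub_of_add_eq e
  have hfG : ∀ u ∈ X, u * f ∈ ambG X := by
    intro u hu
    rw [hfe, mul_sub, ← mul_assoc]
    exact sub_mem (XXX_ambG hu ha hb) (XX_ambG hu hx)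
  rw [← e, mul_add]
  refine Pr.add hΓ (k := 4) (k' := 2) ⟨(hg.2 f hfT).2, fun γ hγ => ?_⟩ (hX x hx)
  rw [sub_mul, gamma_sub (hΓ γ hγ) (hfG s hs) (hfG s' hs')]
  exact ((hg.1 γ hγ).2 f hfT).2

lemma NC.mulF {X F T : Finset R} {K : ℕ} (hsym : ∀ x ∈ X, -x ∈ X)
    (hmul : X * X ⊆ F + X) (hFK : F.card ≤ K)
    (hT : ∀ f, f ∈ T ↔ f ∈ F ∧ ∃ y ∈ X, ∃ z ∈ X, ∃ x ∈ X, f + x = y * z) {f : R} (hf : f ∈ T) :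
    NC X ((K + 1) * (K + 1)) (fun s s' => f * (s - s') ∈ ZZ X 0 4 ∧ (s - s') * f ∈ ZZ X 0 4) := by
  obtain ⟨-, y, hy, z, hz, x, hx, e⟩ := (hT f).1 hf
  have hfe : f = y * z - x := eq_sub_of_add_eq e
  have h1 := NC.shift (X := X) hFK (fun s => z * s)
    (fun s hs => hmul (Finset.mul_mem_mul hz hs))
  have h2 := NC.shift (X := X) hFK (fun s => s * y)
    (fun s hs => hmul (Finset.mul_mem_mul hs hy))
  refine (h1.and h2).mono le_rfl ?_
  rintro s hs s' hs' ⟨⟨a, ha, a', ha', ea⟩, ⟨b, hb, b', hb', eb⟩⟩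
  constructor
  · have h3 : f * (s - s') = (y * a - y * a') - (x * s - x * s') := by
      rw [hfe, ← mul_sub y a a', ← ea]
      simp only [mul_sub, sub_mul, mul_assoc]
      abel
    rw [h3]
    exact sub_mem_ZZ hsym (sub_mem_ZZ hsym (mul_mem_ZZ_one hy ha) (mul_mem_ZZ_one hy ha'))
      (sub_mem_ZZ hsym (mul_mem_ZZ_one hx hs) (mul_mem_ZZ_one hx hs'))
  · have h3 : (s - s') * f = (b * z - b' * z) - (s * x - s' * x) := by
      rw [hfe, ← sub_mul b b' z, ← eb]
      simp only [mul_sub, sub_mul, mul_assoc]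
    rw [h3]
    exact sub_mem_ZZ hsym (sub_mem_ZZ hsym (mul_mem_ZZ_one hb hz) (mul_mem_ZZ_one hb' hz))
      (sub_mem_ZZ hsym (mul_mem_ZZ_one hs hx) (mul_mem_ZZ_one hs' hx))

lemma finset_version (K : ℕ) : ∃ C : ℕ, ∀ (R : Type u) [NonUnitalRing R] (X F : Finset R),
    0 ∈ X → (∀ x ∈ X, -x ∈ X) → X + X ⊆ F + X → X * X ⊆ F + X → F.card ≤ K →
    ∃ R' I : Set R, IsSubringSet R' ∧ IsTwoSidedIdealIn I R' ∧
      (∃ E : Finset R, E.card ≤ C ∧ (X : Set R) ⊆ (E : Set R) + R') ∧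
      I ⊆ iterX (X : Set R) 3 ∧ mulIter R' C ⊆ I := by
  obtain ⟨d, m, hbohr⟩ := bohr_structure.{u} K
  obtain ⟨N3, c3, hc3⟩ := circle_coloring (1 / 300) (by norm_num)
  obtain ⟨N8, c8, hc8⟩ := circle_coloring (1 / 8) (by norm_num)
  have hN3 : 0 < N3 := Fin.pos (c3 0)
  have hN8 : 0 < N8 := Fin.pos (c8 0)
  let n1 : ℕ := (m + 1) * (m + 1) * N8 * (N3 * N3) ^ K
  have hn1 : 0 < n1 := by positivity
  let n : ℕ := n1 ^ d * ((K + 1) * (K + 1)) ^ K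
  refine ⟨max n (9 ^ d), ?_⟩
  intro R _ X F h0 hsym hadd hmul hFK
  obtain ⟨Γ, hΓd, hΓ, hbog, hcol⟩ := hbohr R X F h0 hsym hadd hmul hFK
  let T : Finset R := F.filter (fun f => ∃ y ∈ X, ∃ z ∈ X, ∃ x ∈ X, f + x = y * z)
  have hT : ∀ f, f ∈ T ↔ f ∈ F ∧ ∃ y ∈ X, ∃ z ∈ X, ∃ x ∈ X, f + x = y * z :=
    fun f => Finset.mem_filter
  have hTK : T.card ≤ K := (Finset.card_le_card (Finset.filter_subset _ _)).trans hFK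
  have hNC : NC X n (Good X T Γ) := by
    refine NC.and (NC.all Γ hn1 hΓd fun γ hγ => ?_) (NC.all T (by positivity) hTK fun f hf => ?_)
    · refine NC.and (NC.and (NC.and (hcol γ hγ).1 (hcol γ hγ).2) (NC.circle hc8 γ))
        (NC.all T (by positivity) hTK fun f _ => ?_)
      exact NC.and (NC.circle hc3 fun s => γ (f * s)) (NC.circle hc3 fun s => γ (s * f))
    · exact NC.mulF hsym hmul hFK hT hf
  obtain ⟨E, hE, hcov⟩ := hNC.cover
  have hnorm : ∀ (x : R) (r : ℝ), 0 ≤ r →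
      (‖(fun γ : {γ // γ ∈ Γ} => γ.1 x)‖ ≤ r ↔ ∀ γ ∈ Γ, ‖γ x‖ ≤ r) := by
    intro x r hr
    rw [pi_norm_le_iff_of_nonneg hr]
    exact ⟨fun h γ hγ => h ⟨γ, hγ⟩, fun h γ => h γ.1 γ.2⟩
  have hWmem : ∀ u, Pr X Γ 32 (1 / 32) u → u ∈ ZZ X 4 4 := by
    intro u hu
    refine hbog u (ZZ_mono h0 (by norm_num) le_rfl hu.1) fun γ hγ => (hu.2 γ hγ).trans ?_
    norm_num
  let D : EndData R {γ // γ ∈ Γ} :=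
    { G := ambG X
      φ := fun x γ => γ.1 x
      W := (ZZ X 4 4 : Finset R)
      S := {t | ∃ s ∈ X, ∃ s' ∈ X, Good X T Γ s s' ∧ t = s - s'}
      Wfin := Finset.finite_toSet _
      WG := fun w hw => ZZ_ambG (Finset.mem_coe.1 hw)
      W0 := Finset.mem_coe.2 (zero_mem_ZZ h0 4 4)
      Wneg := fun w hw => Finset.mem_coe.2 (neg_mem_ZZ hsym (Finset.mem_coe.1 hw))
      φadd := fun x hx y hy => funext fun γ => hΓ γ.1 γ.2 x hx y hy
      cl := by
        intro x hx y hy _ _ h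
        rw [hnorm _ _ (by norm_num)] at h
        refine Finset.mem_coe.2 (hbog _ ?_ h)
        exact ZZ_mono h0 (by norm_num) (by norm_num)
          (ZZ_add (Finset.mem_coe.1 hx) (Finset.mem_coe.1 hy))
      SW := by
        rintro t ⟨s, hs, s', hs', hg, rfl⟩
        refine ⟨Finset.mem_coe.2 (ZZ_mono h0 (by norm_num) (by norm_num)
          (sub_mem_ZZ hsym (mem_ZZ_one hs) (mem_ZZ_one hs'))), ?_⟩
        rw [hnorm _ _ (by norm_num)]
        intro γ hγ
        rw [gamma_sub (hΓ γ hγ) (X_ambG hs) (X_ambG hs')]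
        exact (hg.1 γ hγ).1.2
      left := by
        rintro t ⟨s, hs, s', hs', hg, rfl⟩ w hw _
        have h := hg.right h0 hsym hmul hT hΓ hs hs' (Finset.mem_coe.1 hw)
        refine ⟨Finset.mem_coe.2 (hWmem _ h), ?_⟩
        rw [hnorm _ _ (by norm_num)]
        exact h.2
      right := by
        rintro t ⟨s, hs, s', hs', hg, rfl⟩ w hw _
        have h := hg.left h0 hsym hmul hT hΓ hs hs' (Finset.mem_coe.1 hw)
        refine ⟨Finset.mem_coe.2 (hWmem _ h), ?_⟩
        rw [hnorm _ _ (by norm_num)]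
        exact h.2 }
  obtain ⟨R', I, hR', hI, hS, hIW, hnil⟩ := D.conclusion d (by simpa using hΓd)
  refine ⟨R', I, hR', hI, ⟨E, hE.trans (le_max_left _ _), ?_⟩, ?_, hnil _ (le_max_right _ _)⟩
  · intro s hs
    obtain ⟨e, he, heX, hg⟩ := hcov s hs
    exact Set.mem_add.2 ⟨e, he, s - e, hS ⟨s, hs, e, heX, hg, rfl⟩, by abel⟩
  · intro w hw
    exact ZZ_iterX h0 (Finset.mem_coe.1 (hIW hw))

end Assembly

/-- Structure theorem for finite approximate subrings: for every `K` there is `C = C(K)` such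
that every finite `K`-approximate subring `X` admits a subring `R'` and a two-sided ideal
`I ⊴ R'` with (1) `X` covered by `C` additive cosets of `R'`, (2) `I ⊆ X₃`, and
(3) `R'/I` nilpotent of class at most `C` (every product of `C+1` elements of `R'` lies
in `I`). -/
theorem stmt0 (K : ℕ) :
    ∃ C : ℕ, ∀ (R : Type u) [NonUnitalRing R] (X : Set R),
      X.Finite → IsApproxSubringWith K X →
      ∃ R' I : Set R, IsSubringSet R' ∧ IsTwoSidedIdealIn I R' ∧
        (∃ F : Finset R, F.card ≤ C ∧ X ⊆ (F : Set R) + R') ∧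
        I ⊆ iterX X 3 ∧
        mulIter R' C ⊆ I := by
  obtain ⟨C, hC⟩ := finset_version.{u} K
  refine ⟨C, ?_⟩
  intro R _ X hfin happ
  obtain ⟨⟨h0, hsym⟩, F, hFK, hsub⟩ := happ
  classical
  lift X to Finset R using hfin
  refine hC R X F (Finset.mem_coe.1 h0) ?_ ?_ ?_ hFK
  · intro x hx
    have h1 : x ∈ -(X : Set R) := by rw [← hsym]; exact hx
    exact h1
  · intro x hx
    rw [← Finset.mem_coe, Finset.coe_add] at hx ⊢
    exact hsub (Or.inr hx)
  · intro x hx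
    rw [← Finset.mem_coe, Finset.coe_mul] at hx
    rw [← Finset.mem_coe, Finset.coe_add]
    exact hsub (Or.inl hx)
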